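/- If G is a (finite simple) graph with maximum degree Δ = 5, then G has a strong edge-coloring that uses at most 37 colors; that is, χ'_s(G) ≤ 37. -/

import Mathlib

open SimpleGraph

/-- Two edges (given as elements of `Sym2 V`) are at distance at most two in `G`:
they share an endpoint, or some endpoint of one is adjacent to some endpoint of the other. -/
def EdgesNear {V : Type*} (G : SimpleGraph V) (e f : Sym2 V) : Prop :=
  (∃ x, x ∈ e ∧ x ∈ f) ∨ (∃ x y, x ∈ e ∧ y ∈ f ∧ G.Adj x y)

/-- A strong edge-coloring of `G` with colors in `Fin k`: any two distinct edges at
distance at most two receive different colors. -/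
def IsStrongEdgeColoring {V : Type*} (G : SimpleGraph V) {k : ℕ}
    (c : G.edgeSet → Fin k) : Prop :=
  ∀ e f : G.edgeSet, e ≠ f → EdgesNear G (e : Sym2 V) (f : Sym2 V) → c e ≠ c f


namespace StrongEdgeColoring

lemma edgesNear_symm {V : Type*} {G : SimpleGraph V} {e f : Sym2 V} (h : EdgesNear G e f) :
    EdgesNear G f e := by
  rcases h with ⟨x, h1, h2⟩ | ⟨x, y, h1, h2, h3⟩
  · exact Or.inl ⟨x, h2, h1⟩
  · exact Or.inr ⟨y, x, h2, h1, h3.symm⟩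

section Distance

variable {V : Type*} {G : SimpleGraph V}

/-- The smaller of the distances from `v` to the two endpoints of an edge. -/
noncomputable def edgeDist (G : SimpleGraph V) (v : V) : Sym2 V → ℕ :=
  Sym2.lift ⟨fun x y => min (G.dist v x) (G.dist v y), fun _ _ => min_comm _ _⟩

@[simp] lemma edgeDist_mk (v x y : V) :
    edgeDist G v s(x, y) = min (G.dist v x) (G.dist v y) := rfl

lemma exists_adj_dist_lt (hG : G.Connected) {v x : V} (hx : x ≠ v) :
    ∃ w, G.Adj x w ∧ G.dist v w < G.dist v x := by
  obtain ⟨q, hq⟩ := hG.exists_walk_length_eq_dist x v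
  cases q with
  | nil => exact absurd rfl hx
  | cons h q =>
    refine ⟨_, h, ?_⟩
    have := SimpleGraph.dist_le q
    rw [Walk.length_cons] at hq
    rw [SimpleGraph.dist_comm (u := v), SimpleGraph.dist_comm (u := v)]
    omega

end Distance

section Precoloring

variable {V : Type*} {G : SimpleGraph V}

/-- Near edges receive distinct precolors. -/
def ProperPrecoloring (G : SimpleGraph V) (p : Sym2 V → Option (Fin 37)) : Prop :=
  ∀ e f i, e ≠ f → EdgesNear G e f → p e = some i → p f ≠ some i

lemma properPrecoloring_none : ProperPrecoloring G fun _ => none := by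
  intro e f i _ _ h
  simp at h

variable [DecidableEq V]

/-- Precolor the edges in `M` with one color and those in `N` with another. -/
def precolor (M N : Finset (Sym2 V)) (e : Sym2 V) : Option (Fin 37) :=
  if e ∈ M then some 0 else if e ∈ N then some 1 else none

/-- No two edges of `M` are near each other. -/
def Apart (G : SimpleGraph V) (M : Finset (Sym2 V)) : Prop :=
  ∀ e ∈ M, ∀ f ∈ M, e ≠ f → ¬ EdgesNear G e f

/-- No two edges of `M` share an endpoint. -/
def EdgesDisjoint (M : Finset (Sym2 V)) : Prop :=
  ∀ e ∈ M, ∀ f ∈ M, ∀ x ∈ e, x ∈ f → e = f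

lemma precolor_eq_none {M N : Finset (Sym2 V)} {e : Sym2 V} :
    precolor M N e = none ↔ e ∉ M ∪ N := by
  unfold precolor
  split_ifs <;> simp_all

lemma properPrecoloring_precolor {M N : Finset (Sym2 V)} (hM : Apart G M) (hN : Apart G N) :
    ProperPrecoloring G (precolor M N) := by
  intro e f i hef hn he hf
  have := hM e
  have := hN e
  unfold precolor at he hf
  grind

lemma precolor_endpoint_unique {M N : Finset (Sym2 V)} (h : EdgesDisjoint (M ∪ N)) (w y y' : V)
    (hy : precolor M N s(w, y) ≠ none) (hy' : precolor M N s(w, y') ≠ none) : y = y' := by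
  simp only [ne_eq, precolor_eq_none, not_not] at hy hy'
  exact Sym2.congr_right.1 (h _ hy _ hy' w (Sym2.mem_mk_left _ _) (Sym2.mem_mk_left _ _))

end Precoloring

section Greedy

variable {V : Type*} [Fintype V] [DecidableEq V] (G : SimpleGraph V) [DecidableRel G.Adj]

/-- The neighbors of `u` or `v` other than `u` and `v`, for an edge `uv` of a graph. -/
def linkVerts (u v : V) : Finset V :=
  (G.neighborFinset u).erase v ∪ (G.neighborFinset v).erase u

/-- The darts leaving a vertex of `linkVerts G u v`. -/
def nearDarts (u v : V) : Finset (V × V) :=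
  Finset.univ.filter fun d => d.1 ∈ linkVerts G u v ∧ G.Adj d.1 d.2

/-- The edges other than `uv` at distance at most two from the edge `uv`. -/
def nearEdges (u v : V) : Finset (Sym2 V) :=
  (nearDarts G u v).image fun d => s(d.1, d.2)

/-- Precolored edges are identified when they have the same color. -/
def colorKey (p : Sym2 V → Option (Fin 37)) (e : Sym2 V) : Fin 37 ⊕ Sym2 V :=
  (p e).elim (Sum.inr e) Sum.inl

/-- The classes of edges near `uv` under `colorKey`. -/
def nearKeys (p : Sym2 V → Option (Fin 37)) (u v : V) : Finset (Fin 37 ⊕ Sym2 V) :=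
  (nearEdges G u v).image (colorKey p)

/-- When edges are colored in order of decreasing rank, starting from the precoloring `p`,
at most 36 colors are forbidden at `uv`. -/
def Slack (p : Sym2 V → Option (Fin 37)) (r : Sym2 V → ℕ) (u v : V) : Prop :=
  ∃ L : Finset (Sym2 V), L ⊆ nearEdges G u v ∧ (∀ f ∈ L, p f = none ∧ r f < r s(u, v)) ∧
    (nearKeys G p u v).card ≤ 36 + L.card

variable {G}

lemma mem_linkVerts {u v x : V} :
    x ∈ linkVerts G u v ↔ (x ≠ v ∧ G.Adj u x) ∨ (x ≠ u ∧ G.Adj v x) := by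
  simp [linkVerts]

lemma mem_nearDarts {u v : V} {d : V × V} :
    d ∈ nearDarts G u v ↔ d.1 ∈ linkVerts G u v ∧ G.Adj d.1 d.2 := by
  simp [nearDarts]

lemma linkVerts_comm (u v : V) : linkVerts G u v = linkVerts G v u :=
  Finset.union_comm _ _

lemma nearEdges_comm (u v : V) : nearEdges G u v = nearEdges G v u := by
  simp [nearEdges, nearDarts, linkVerts_comm]

lemma nearKeys_comm (p : Sym2 V → Option (Fin 37)) (u v : V) :
    nearKeys G p u v = nearKeys G p v u := by
  simp [nearKeys, nearEdges_comm]

lemma slack_comm {p : Sym2 V → Option (Fin 37)} {r : Sym2 V → ℕ} {u v : V}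
    (h : Slack G p r u v) : Slack G p r v u := by
  unfold Slack at *
  rwa [nearKeys_comm, nearEdges_comm, Sym2.eq_swap]

lemma mem_nearEdges_of_left {u v x y : V} (hx : G.Adj u x) (hxv : x ≠ v) (hxy : G.Adj x y) :
    s(x, y) ∈ nearEdges G u v :=
  Finset.mem_image.2 ⟨(x, y), mem_nearDarts.2 ⟨mem_linkVerts.2 (Or.inl ⟨hxv, hx⟩), hxy⟩, rfl⟩

lemma mem_nearEdges_of_right {u v x y : V} (hx : G.Adj v x) (hxu : x ≠ u) (hxy : G.Adj x y) :
    s(x, y) ∈ nearEdges G u v :=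
  nearEdges_comm (G := G) v u ▸ mem_nearEdges_of_left hx hxu hxy

lemma mem_nearEdges_of_near {u v x y : V} (huv : G.Adj u v) (hxy : G.Adj x y)
    (hne : s(x, y) ≠ s(u, v)) (h : EdgesNear G s(u, v) s(x, y)) :
    s(x, y) ∈ nearEdges G u v := by
  have key : x ∈ linkVerts G u v ∨ y ∈ linkVerts G u v := by
    simp only [mem_linkVerts]
    unfold EdgesNear at h
    simp only [Sym2.mem_iff] at h
    simp only [ne_eq, Sym2.eq_iff, not_or, not_and] at hne
    grind [G.adj_comm]
  rcases key with h | h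
  · exact Finset.mem_image.2 ⟨(x, y), mem_nearDarts.2 ⟨h, hxy⟩, rfl⟩
  · exact Finset.mem_image.2 ⟨(y, x), mem_nearDarts.2 ⟨h, hxy.symm⟩, Sym2.eq_swap⟩

/-- Greedy extension of a precoloring. -/
theorem exists_coloring_of_slack {p : Sym2 V → Option (Fin 37)} (hp : ProperPrecoloring G p)
    (r : Sym2 V → ℕ) (h : ∀ u v, G.Adj u v → p s(u, v) = none → Slack G p r u v) :
    ∃ c : G.edgeSet → Fin 37, IsStrongEdgeColoring G c := by
  have main : ∀ S : Finset (Sym2 V), (∀ e ∈ S, e ∈ G.edgeSet ∧ p e = none) →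
      ∃ c : Sym2 V → Fin 37, (∀ e i, p e = some i → c e = i) ∧
        ∀ e ∈ G.edgeSet, ∀ f ∈ G.edgeSet, (e ∈ S ∨ p e ≠ none) → (f ∈ S ∨ p f ≠ none) →
          e ≠ f → EdgesNear G e f → c e ≠ c f := by
    intro S
    induction S using Finset.induction_on_min_value r with
    | empty =>
      intro _
      refine ⟨fun e => (p e).getD 0, fun e i h => by simp [h], ?_⟩
      intro e _ f _ he' hf' hef hn
      obtain ⟨i, hi⟩ := Option.ne_none_iff_exists'.1 (by simpa using he')
      obtain ⟨j, hj⟩ := Option.ne_none_iff_exists'.1 (by simpa using hf')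
      have := hp e f i hef hn hi
      simp only [hi, hj, Option.getD_some]
      rintro rfl
      exact this hj
    | insert a S haS hmin ih =>
      intro hS
      obtain ⟨c, hc1, hc2⟩ := ih fun e he => hS e (Finset.mem_insert_of_mem he)
      obtain ⟨haE, hap⟩ := hS a (Finset.mem_insert_self _ _)
      induction a using Sym2.ind with
      | _ u v =>
      obtain ⟨L, hL1, hL2, hL3⟩ := h u v haE hap
      let K := nearKeys G p u v \ L.image Sum.inr
      have hsub : L.image Sum.inr ⊆ nearKeys G p u v := by
        intro k hk
        obtain ⟨f, hf, rfl⟩ := Finset.mem_image.1 hk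
        exact Finset.mem_image.2 ⟨f, hL1 hf, by simp [colorKey, (hL2 f hf).1]⟩
      have hK : K.card ≤ 36 := by
        rw [Finset.card_sdiff_of_subset hsub,
          Finset.card_image_of_injective _ Sum.inr_injective]
        omega
      obtain ⟨i, hi⟩ : ∃ i, i ∉ K.image (Sum.elim id c) := by
        by_contra! hall
        have h1 : (Finset.univ : Finset (Fin 37)) ⊆ K.image (Sum.elim id c) := fun i _ => hall i
        have h2 := Finset.card_le_card h1
        have h3 := (Finset.card_image_le (s := K) (f := Sum.elim id c))
        simp at h2
        omega
      have hfree : ∀ f ∈ G.edgeSet, (f ∈ S ∨ p f ≠ none) → f ≠ s(u, v) →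
          EdgesNear G s(u, v) f → c f ≠ i := by
        intro f hfE hf hne hn hci
        apply hi
        induction f using Sym2.ind with
        | _ x y =>
        refine Finset.mem_image.2 ⟨colorKey p s(x, y), Finset.mem_sdiff.2
          ⟨Finset.mem_image_of_mem _ (mem_nearEdges_of_near haE hfE hne hn), ?_⟩, ?_⟩
        · intro hk
          obtain ⟨g, hg, hgk⟩ := Finset.mem_image.1 hk
          have hpf : p s(x, y) = none := by
            by_contra hpf
            obtain ⟨j, hj⟩ := Option.ne_none_iff_exists'.1 hpf
            simp [colorKey, hj] at hgk
          have : g = s(x, y) := by simpa [colorKey, hpf] using hgk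
          subst this
          have h1 := hmin _ (hf.resolve_right (by simp [hpf]))
          have h2 := (hL2 _ hg).2
          omega
        · rcases hpf : p s(x, y) with _ | j
          · simp [colorKey, hpf, hci]
          · simpa [colorKey, hpf, hc1 _ _ hpf] using hci
      refine ⟨Function.update c s(u, v) i, ?_, ?_⟩
      · intro e j hj
        rw [Function.update_of_ne (by rintro rfl; simp [hap] at hj)]
        exact hc1 e j hj
      · intro e he f hf he' hf' hef hn
        by_cases h1 : e = s(u, v)
        · subst h1
          rw [Function.update_self, Function.update_of_ne hef.symm]
          exact (hfree f hf (by grind) hef.symm hn).symm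
        · by_cases h2 : f = s(u, v)
          · subst h2
            rw [Function.update_self, Function.update_of_ne hef]
            exact hfree e he (by grind) hef (edgesNear_symm hn)
          · rw [Function.update_of_ne h1, Function.update_of_ne h2]
            exact hc2 e he f hf (by grind) (by grind) hef hn
  obtain ⟨c, -, hc⟩ := main (Finset.univ.filter fun e => e ∈ G.edgeSet ∧ p e = none) (by simp)
  refine ⟨fun e => c e, fun e f hef hn => hc e e.2 f f.2 ?_ ?_
    (by simpa [Subtype.ext_iff] using hef) hn⟩
  · by_cases h : p e = none <;> simp [h]
  · by_cases h : p f = none <;> simp [h]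

end Greedy

section Counting

variable {V : Type*} [Fintype V] [DecidableEq V] {G : SimpleGraph V} [DecidableRel G.Adj]

lemma card_nearDarts (u v : V) :
    (nearDarts G u v).card = ∑ x ∈ linkVerts G u v, G.degree x := by
  rw [Finset.card_eq_sum_card_fiberwise (f := Prod.fst) (t := linkVerts G u v)
    (fun d hd => (mem_nearDarts.1 hd).1)]
  refine Finset.sum_congr rfl fun x hx => ?_
  rw [← G.card_neighborFinset_eq_degree x]
  refine Finset.card_bij (fun d _ => d.2) ?_ ?_ ?_
  · rintro ⟨y, z⟩ hd
    simp only [Finset.mem_filter, mem_nearDarts] at hd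
    simpa [← hd.2] using hd.1.2
  · rintro ⟨y, z⟩ hd ⟨y', z'⟩ hd' h
    simp only [Finset.mem_filter] at hd hd'
    ext
    · exact hd.2.trans hd'.2.symm
    · exact h
  · intro z hz
    exact ⟨(x, z), by simpa [mem_nearDarts, hx] using hz, rfl⟩

lemma card_linkVerts_add_two_le {u v : V} (huv : G.Adj u v) :
    (linkVerts G u v).card + 2 ≤ G.degree u + G.degree v := by
  have h1 := Finset.card_union_le ((G.neighborFinset u).erase v) ((G.neighborFinset v).erase u)
  have h2 := Finset.card_erase_add_one ((G.mem_neighborFinset u v).2 huv)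
  have h3 := Finset.card_erase_add_one ((G.mem_neighborFinset v u).2 huv.symm)
  rw [G.card_neighborFinset_eq_degree] at h2 h3
  unfold linkVerts
  omega

lemma card_nearEdges_le_card_nearDarts (u v : V) :
    (nearEdges G u v).card ≤ (nearDarts G u v).card :=
  Finset.card_image_le

lemma card_nearKeys_le_card_nearEdges (p : Sym2 V → Option (Fin 37)) (u v : V) :
    (nearKeys G p u v).card ≤ (nearEdges G u v).card :=
  Finset.card_image_le

lemma card_nearDarts_le_mul (hdeg : ∀ x, G.degree x ≤ 5) (u v : V) :
    (nearDarts G u v).card ≤ (linkVerts G u v).card * 5 := by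
  rw [card_nearDarts]
  exact Finset.sum_le_card_nsmul _ _ _ fun x _ => hdeg x

lemma card_nearDarts_le (hdeg : ∀ x, G.degree x ≤ 5) {u v : V} (huv : G.Adj u v) :
    (nearDarts G u v).card ≤ 40 := by
  have := card_nearDarts_le_mul hdeg u v
  have := card_linkVerts_add_two_le huv
  have := hdeg u
  have := hdeg v
  omega

lemma card_nearDarts_le_add_degree (hdeg : ∀ x, G.degree x ≤ 5) {u v w : V} (huv : G.Adj u v)
    (hw : w ∈ linkVerts G u v) : (nearDarts G u v).card ≤ 35 + G.degree w := by
  have h1 := card_linkVerts_add_two_le huv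
  have h2 := hdeg u
  have h3 := hdeg v
  have h4 := Finset.card_erase_add_one hw
  have h5 : ∑ x ∈ (linkVerts G u v).erase w, G.degree x ≤ ((linkVerts G u v).erase w).card * 5 :=
    Finset.sum_le_card_nsmul _ _ _ fun x _ => hdeg x
  rw [card_nearDarts, ← Finset.sum_erase_add _ _ hw]
  omega

/-- The pairs completing the edge `ab` to a 4-cycle. -/
def squares (G : SimpleGraph V) [DecidableRel G.Adj] (a b : V) : Finset (V × V) :=
  Finset.univ.filter fun d =>
    G.Adj a d.1 ∧ d.1 ≠ b ∧ G.Adj b d.2 ∧ d.2 ≠ a ∧ G.Adj d.1 d.2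

lemma mem_squares {a b x y : V} : (x, y) ∈ squares G a b ↔
    G.Adj a x ∧ x ≠ b ∧ G.Adj b y ∧ y ≠ a ∧ G.Adj x y := by
  simp [squares]

lemma card_squares_comm (a b : V) : (squares G a b).card = (squares G b a).card := by
  refine Finset.card_bij (fun d _ => d.swap) ?_ ?_ ?_
  · rintro ⟨x, y⟩ h
    simp only [mem_squares, Prod.swap] at *
    grind [G.adj_comm]
  · rintro ⟨x, y⟩ - ⟨x', y'⟩ - h
    simpa [and_comm] using h
  · rintro ⟨x, y⟩ h
    refine ⟨(y, x), ?_, rfl⟩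
    simp only [mem_squares] at *
    grind [G.adj_comm]

lemma card_mul_card_le_card_squares {a b : V} (P R : Finset V)
    (hP : ∀ x ∈ P, G.Adj a x ∧ x ≠ b) (hR : ∀ y ∈ R, G.Adj b y ∧ y ≠ a)
    (hPR : ∀ x ∈ P, ∀ y ∈ R, G.Adj x y) : P.card * R.card ≤ (squares G a b).card := by
  rw [← Finset.card_product]
  refine Finset.card_le_card ?_
  rintro ⟨x, y⟩ h
  rw [Finset.mem_product] at h
  exact mem_squares.2 ⟨(hP x h.1).1, (hP x h.1).2, (hR y h.2).1, (hR y h.2).2, hPR x h.1 y h.2⟩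

/-- If every element of `D` has the same image as one outside `D`, then `D` is redundant. -/
lemma card_image_add_card_le {α β : Type*} [DecidableEq α] [DecidableEq β] {f : α → β}
    {I D : Finset α} (hDI : D ⊆ I) (hD : ∀ d ∈ D, ∃ d' ∈ I, d' ∉ D ∧ f d' = f d) :
    (I.image f).card + D.card ≤ I.card := by
  have h : I.image f ⊆ (I \ D).image f := by
    intro k hk
    obtain ⟨d, hd, rfl⟩ := Finset.mem_image.1 hk
    by_cases h : d ∈ D
    · obtain ⟨d', h1, h2, h3⟩ := hD d h
      exact Finset.mem_image.2 ⟨d', Finset.mem_sdiff.2 ⟨h1, h2⟩, h3⟩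
    · exact Finset.mem_image_of_mem _ (Finset.mem_sdiff.2 ⟨hd, h⟩)
  have h1 := (Finset.card_le_card h).trans Finset.card_image_le
  rw [Finset.card_sdiff_of_subset hDI] at h1
  have := Finset.card_le_card hDI
  omega

/-- `G` has no triangles. -/
def TriangleFree (G : SimpleGraph V) : Prop :=
  ∀ x y z, G.Adj x y → G.Adj y z → ¬ G.Adj x z

lemma card_nearEdges_add_card_squares_le (hdeg : ∀ x, G.degree x ≤ 5) (htf : TriangleFree G)
    {a b : V} (hab : G.Adj a b) :
    (nearEdges G a b).card + (squares G a b).card ≤ 40 := by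
  refine le_trans (card_image_add_card_le ?_ ?_) (card_nearDarts_le hdeg hab)
  · rintro ⟨x, y⟩ h
    rw [mem_squares] at h
    exact mem_nearDarts.2 ⟨mem_linkVerts.2 (Or.inl ⟨h.2.1, h.1⟩), h.2.2.2.2⟩
  · rintro ⟨x, y⟩ h
    rw [mem_squares] at h
    refine ⟨(y, x), mem_nearDarts.2 ⟨mem_linkVerts.2 (Or.inr ⟨h.2.2.2.1, h.2.2.1⟩),
      h.2.2.2.2.symm⟩, ?_, Sym2.eq_swap⟩
    rw [mem_squares]
    exact fun h' => htf a b y hab h.2.2.1 h'.1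

lemma card_nearKeys_add_card_le {p : Sym2 V → Option (Fin 37)} {C : Finset (Fin 37)}
    (hC : ∀ e i, p e = some i → i ∈ C) {u v : V} {M : Finset (Sym2 V)}
    (hM : M ⊆ nearEdges G u v) (hMp : ∀ e ∈ M, p e ≠ none) :
    (nearKeys G p u v).card + M.card ≤ (nearEdges G u v).card + C.card := by
  have h : nearKeys G p u v ⊆ C.image Sum.inl ∪ (nearEdges G u v \ M).image Sum.inr := by
    intro k hk
    obtain ⟨e, he, rfl⟩ := Finset.mem_image.1 hk
    rcases hpe : p e with _ | i
    · have : e ∉ M := fun h => hMp e h hpe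
      simp [colorKey, hpe, he, this]
    · simp [colorKey, hpe, hC e i hpe]
  have h1 := (Finset.card_le_card h).trans (Finset.card_union_le _ _)
  rw [Finset.card_image_of_injective _ Sum.inl_injective,
    Finset.card_image_of_injective _ Sum.inr_injective, Finset.card_sdiff_of_subset hM] at h1
  have := Finset.card_le_card hM
  omega

/-- An edge has slack if all but one of the edges at a vertex near it are colored later. -/
lemma slack_of_later_vertex (hdeg : ∀ x, G.degree x ≤ 5) {p : Sym2 V → Option (Fin 37)}
    {r : Sym2 V → ℕ} {u v w : V} (huv : G.Adj u v) (huw : G.Adj u w) (hwv : w ≠ v)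
    (hr : ∀ y, G.Adj w y → r s(w, y) < r s(u, v))
    (hp : ∀ y y', G.Adj w y → G.Adj w y' → p s(w, y) ≠ none → p s(w, y') ≠ none → y = y') :
    Slack G p r u v := by
  refine ⟨((G.neighborFinset w).filter fun y => p s(w, y) = none).image fun y => s(w, y),
    ?_, ?_, ?_⟩
  · intro f hf
    simp only [Finset.mem_image, Finset.mem_filter, mem_neighborFinset] at hf
    obtain ⟨y, ⟨hy, -⟩, rfl⟩ := hf
    exact mem_nearEdges_of_left huw hwv hy
  · intro f hf
    simp only [Finset.mem_image, Finset.mem_filter, mem_neighborFinset] at hf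
    obtain ⟨y, ⟨hy, hy'⟩, rfl⟩ := hf
    exact ⟨hy', hr y hy⟩
  · rw [Finset.card_image_of_injective _ fun y y' h => Sym2.congr_right.1 h]
    have h1 := Finset.card_filter_add_card_filter_not (s := G.neighborFinset w)
      (fun y => p s(w, y) = none)
    have h2 : ((G.neighborFinset w).filter fun y => ¬ p s(w, y) = none).card ≤ 1 := by
      rw [Finset.card_le_one]
      intro y hy y' hy'
      simp only [Finset.mem_filter, mem_neighborFinset] at hy hy'
      exact hp y y' hy.1 hy'.1 hy.2 hy'.2
    rw [G.card_neighborFinset_eq_degree] at h1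
    have h3 := card_nearDarts_le_add_degree hdeg huv
      (mem_linkVerts.2 (Or.inl ⟨hwv, huw⟩))
    have h4 := card_nearEdges_le_card_nearDarts (G := G) u v
    have h5 := card_nearKeys_le_card_nearEdges (G := G) p u v
    omega

/-- Edges avoiding the root `a` have slack when edges closer to `a` are colored later. -/
lemma slack_of_far (hG : G.Connected) (hdeg : ∀ x, G.degree x ≤ 5)
    {p : Sym2 V → Option (Fin 37)} {r : Sym2 V → ℕ} {a u v : V}
    (hp : ∀ w y y', G.Adj w y → G.Adj w y' → p s(w, y) ≠ none → p s(w, y') ≠ none → y = y')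
    (hr : ∀ f, edgeDist G a f < edgeDist G a s(u, v) → r f < r s(u, v))
    (huv : G.Adj u v) (hua : u ≠ a) (hva : v ≠ a) : Slack G p r u v := by
  wlog h : G.dist a u ≤ G.dist a v generalizing u v
  · exact slack_comm (this (by rwa [Sym2.eq_swap]) huv.symm hva hua (by omega))
  obtain ⟨w, huw, hw⟩ := exists_adj_dist_lt hG hua
  refine slack_of_later_vertex hdeg huv huw (by rintro rfl; omega) (fun y _ => hr _ ?_) (hp w)
  simp only [edgeDist_mk]
  omega

end Counting

section Kernels

variable {V : Type*} [Fintype V] [DecidableEq V] {G : SimpleGraph V} [DecidableRel G.Adj]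

theorem exists_coloring_of_degree_le_four (hG : G.Connected) (hdeg : ∀ x, G.degree x ≤ 5)
    {a : V} (ha : G.degree a ≤ 4) :
    ∃ c : G.edgeSet → Fin 37, IsStrongEdgeColoring G c := by
  refine exists_coloring_of_slack properPrecoloring_none (edgeDist G a) fun u v huv _ => ?_
  have near : ∀ x, G.Adj a x → Slack G (fun _ => none) (edgeDist G a) a x := by
    intro x hx
    refine ⟨∅, by simp, by simp, ?_⟩
    have h1 := card_nearDarts_le_mul hdeg a x
    have h2 := card_linkVerts_add_two_le hx
    have h3 := hdeg x
    have h4 := card_nearEdges_le_card_nearDarts (G := G) a x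
    have h5 := card_nearKeys_le_card_nearEdges (G := G) (fun _ => none) a x
    rw [Finset.card_empty]
    omega
  by_cases hu : u = a
  · subst hu
    exact near v huv
  by_cases hv : v = a
  · subst hv
    exact slack_comm (near u huv.symm)
  exact slack_of_far hG hdeg (by simp) (fun _ h => h) huv hu hv

lemma card_nearDarts_le_of_triangle (hdeg : ∀ x, G.degree x ≤ 5) {a b c : V} (hab : G.Adj a b)
    (hac : G.Adj a c) (hbc : G.Adj b c) : (nearDarts G a b).card ≤ 35 := by
  have h1 := card_nearDarts_le_mul hdeg a b
  have h2 := Finset.card_union_add_card_inter ((G.neighborFinset a).erase b)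
    ((G.neighborFinset b).erase a)
  have h3 : 0 < ((G.neighborFinset a).erase b ∩ (G.neighborFinset b).erase a).card :=
    Finset.card_pos.2 ⟨c, by simp [hac, hbc, hac.ne']⟩
  have h4 := Finset.card_erase_add_one ((G.mem_neighborFinset a b).2 hab)
  have h5 := Finset.card_erase_add_one ((G.mem_neighborFinset b a).2 hab.symm)
  rw [G.card_neighborFinset_eq_degree] at h4 h5
  have h6 := hdeg a
  have h7 := hdeg b
  unfold linkVerts at h1
  omega

theorem exists_coloring_of_triangle (hG : G.Connected) (hdeg : ∀ x, G.degree x ≤ 5)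
    {a b c : V} (hab : G.Adj a b) (hac : G.Adj a c) (hbc : G.Adj b c) :
    ∃ c : G.edgeSet → Fin 37, IsStrongEdgeColoring G c := by
  let T : Finset (Sym2 V) := {s(a, b), s(a, c), s(b, c)}
  let r : Sym2 V → ℕ := fun e => if e ∈ T then 0 else 1 + edgeDist G a e
  refine exists_coloring_of_slack properPrecoloring_none r fun u v huv _ => ?_
  have tri : ∀ x y z, G.Adj x y → G.Adj x z → G.Adj y z → Slack G (fun _ => none) r x y := by
    intro x y z hxy hxz hyz
    refine ⟨∅, by simp, by simp, ?_⟩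
    have h3 := card_nearDarts_le_of_triangle hdeg hxy hxz hyz
    have h4 := card_nearEdges_le_card_nearDarts (G := G) x y
    have h5 := card_nearKeys_le_card_nearEdges (G := G) (fun _ => none) x y
    rw [Finset.card_empty]
    omega
  by_cases hT : s(u, v) ∈ T
  · simp only [T, Finset.mem_insert, Finset.mem_singleton, Sym2.eq_iff] at hT
    rcases hT with (⟨rfl, rfl⟩ | ⟨rfl, rfl⟩) | (⟨rfl, rfl⟩ | ⟨rfl, rfl⟩) |
      (⟨rfl, rfl⟩ | ⟨rfl, rfl⟩)
    exacts [tri _ _ _ hab hac hbc, slack_comm (tri _ _ _ hab hac hbc),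
      tri _ _ _ hac hab hbc.symm, slack_comm (tri _ _ _ hac hab hbc.symm),
      tri _ _ _ hbc hab.symm hac.symm, slack_comm (tri _ _ _ hbc hab.symm hac.symm)]
  have near : ∀ x, G.Adj a x → s(a, x) ∉ T → Slack G (fun _ => none) r a x := by
    intro x hx hxT
    have hxb : b ≠ x := by rintro rfl; simp [T] at hxT
    have hxc : c ≠ x := by rintro rfl; simp [T] at hxT
    refine ⟨T, ?_, ?_, ?_⟩
    · intro f hf
      simp only [T, Finset.mem_insert, Finset.mem_singleton] at hf
      rcases hf with rfl | rfl | rfl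
      · rw [Sym2.eq_swap]
        exact mem_nearEdges_of_left hab hxb hab.symm
      · rw [Sym2.eq_swap]
        exact mem_nearEdges_of_left hac hxc hac.symm
      · exact mem_nearEdges_of_left hab hxb hbc
    · intro f hf
      simp [r, hf, hxT]
    · have hT3 : T.card = 3 := by
        rw [Finset.card_eq_three]
        refine ⟨_, _, _, ?_, ?_, ?_, rfl⟩ <;>
          simp [hab.ne, hab.ne', hac.ne, hbc.ne, hbc.ne']
      have h1 : (nearEdges G a x).card + ({(b, c)} : Finset (V × V)).card ≤
          (nearDarts G a x).card := by
        refine card_image_add_card_le ?_ ?_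
        · simp [mem_nearDarts, mem_linkVerts, hab, hxb, hbc]
        · intro d hd
          rw [Finset.mem_singleton] at hd
          subst hd
          refine ⟨(c, b), ?_, ?_, Sym2.eq_swap⟩
          · simp [mem_nearDarts, mem_linkVerts, hac, hxc, hbc.symm]
          · simp [hbc.ne']
      have h2 := card_nearDarts_le hdeg hx
      have h5 := card_nearKeys_le_card_nearEdges (G := G) (fun _ => none) a x
      rw [Finset.card_singleton] at h1
      omega
  by_cases hu : u = a
  · subst hu
    exact near v huv hT
  by_cases hv : v = a
  · subst hv
    exact slack_comm (near u huv.symm (by rwa [Sym2.eq_swap]))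
  refine slack_of_far hG hdeg (a := a) (by simp) (fun f hf => ?_) huv hu hv
  simp only [r, if_neg hT]
  split_ifs <;> omega

lemma card_nearKeys_precolor_add_card_le {M N : Finset (Sym2 V)} {u v : V}
    {M' : Finset (Sym2 V)} (hM' : M' ⊆ M ∪ N) (h : M' ⊆ nearEdges G u v) :
    (nearKeys G (precolor M N) u v).card + M'.card ≤ (nearEdges G u v).card + 2 := by
  refine card_nearKeys_add_card_le (C := {0, 1}) ?_ h ?_
  · intro e i
    unfold precolor
    split_ifs <;> simp +contextual [eq_comm]
  · intro e he
    exact fun hn => precolor_eq_none.1 hn (hM' he)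

lemma card_nearKeys_precolor_empty_add_card_le {M : Finset (Sym2 V)} {u v : V}
    {M' : Finset (Sym2 V)} (hM' : M' ⊆ M) (h : M' ⊆ nearEdges G u v) :
    (nearKeys G (precolor M ∅) u v).card + M'.card ≤ (nearEdges G u v).card + 1 := by
  refine card_nearKeys_add_card_le (C := {0}) ?_ h ?_
  · intro e i
    unfold precolor
    split_ifs <;> simp +contextual [eq_comm]
    simp_all
  · intro e he
    simpa [precolor_eq_none] using hM' he

/-- A 4-cycle `abcd` whose edges are not precolored can be colored last, if three of its edges
have three redundant near edges and the fourth one has four. -/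
theorem exists_coloring_of_cycle (hG : G.Connected) (hdeg : ∀ x, G.degree x ≤ 5)
    {a b c d : V} (hab : G.Adj a b) (hbc : G.Adj b c) (hcd : G.Adj c d) (hda : G.Adj d a)
    (hac : a ≠ c) (hbd : b ≠ d) {M N : Finset (Sym2 V)} (hM : Apart G M) (hN : Apart G N)
    (hMN : EdgesDisjoint (M ∪ N))
    (hout : ∀ e ∈ ({s(a, b), s(b, c), s(c, d), s(d, a)} : Finset (Sym2 V)), e ∉ M ∪ N)
    (kab : (nearKeys G (precolor M N) a b).card ≤ 36)
    (kbc : (nearKeys G (precolor M N) b c).card ≤ 37)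
    (kcd : (nearKeys G (precolor M N) c d).card ≤ 37)
    (kda : (nearKeys G (precolor M N) d a).card ≤ 37) :
    ∃ c : G.edgeSet → Fin 37, IsStrongEdgeColoring G c := by
  set T : Finset (Sym2 V) := {s(a, b), s(b, c), s(c, d), s(d, a)} with hTdef
  let r : Sym2 V → ℕ := fun e =>
    if e = s(a, b) then 0 else if e ∈ T then 1 else 2 + edgeDist G a e
  refine exists_coloring_of_slack (properPrecoloring_precolor hM hN) r fun u v huv hp => ?_
  have rlt : ∀ e ∉ T, ∀ f ∈ T, r f < r e := by
    intro e he f hf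
    have : e ≠ s(a, b) := by rintro rfl; simp [hTdef] at he
    simp only [r, if_neg he, if_neg this, if_pos hf]
    split_ifs <;> omega
  have rpos : ∀ e ≠ s(a, b), r s(a, b) < r e := by
    intro e he
    simp only [r, if_neg he, if_true]
    split_ifs <;> omega
  have last : Slack G (precolor M N) r a b := ⟨∅, by simp, by simp, by simpa using kab⟩
  have other : ∀ x y, s(a, b) ∈ nearEdges G x y → s(x, y) ≠ s(a, b) →
      (nearKeys G (precolor M N) x y).card ≤ 37 → Slack G (precolor M N) r x y := by
    intro x y h1 h2 h3
    refine ⟨{s(a, b)}, by simpa using h1, ?_, by simpa using h3⟩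
    simp only [Finset.mem_singleton, forall_eq]
    exact ⟨precolor_eq_none.2 (hout _ (by simp [hTdef])), rpos _ h2⟩
  by_cases hT : s(u, v) ∈ T
  · have sbc : Slack G (precolor M N) r b c :=
      other _ _ (mem_nearEdges_of_left hab.symm hac hab) (by simp [hac.symm, hbc.ne']) kbc
    have scd : Slack G (precolor M N) r c d :=
      other _ _ (mem_nearEdges_of_right hda hac hab) (by simp [hac.symm, hbc.ne']) kcd
    have sda : Slack G (precolor M N) r d a :=
      other _ _ (Sym2.eq_swap (a := b) ▸ mem_nearEdges_of_right hab hbd hab.symm)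
        (by simp [hbd.symm, hda.ne]) kda
    simp only [hTdef, Finset.mem_insert, Finset.mem_singleton, Sym2.eq_iff] at hT
    rcases hT with (⟨rfl, rfl⟩ | ⟨rfl, rfl⟩) | (⟨rfl, rfl⟩ | ⟨rfl, rfl⟩) |
      (⟨rfl, rfl⟩ | ⟨rfl, rfl⟩) | (⟨rfl, rfl⟩ | ⟨rfl, rfl⟩)
    exacts [last, slack_comm last, sbc, slack_comm sbc, scd, slack_comm scd, sda, slack_comm sda]
  have near : ∀ x, G.Adj a x → s(a, x) ∉ T → Slack G (precolor M N) r a x := by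
    intro x hx hxT
    have hxb : b ≠ x := by rintro rfl; simp [hTdef] at hxT
    have hxd : d ≠ x := by rintro rfl; simp [hTdef] at hxT
    refine ⟨T, ?_, fun f hf => ⟨precolor_eq_none.2 (hout f hf), rlt _ hxT f hf⟩, ?_⟩
    · intro f hf
      simp only [hTdef, Finset.mem_insert, Finset.mem_singleton] at hf
      rcases hf with rfl | rfl | rfl | rfl
      · rw [Sym2.eq_swap]
        exact mem_nearEdges_of_left hab hxb hab.symm
      · exact mem_nearEdges_of_left hab hxb hbc
      · rw [Sym2.eq_swap]
        exact mem_nearEdges_of_left hda.symm hxd hcd.symm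
      · exact mem_nearEdges_of_left hda.symm hxd hda
    · have hT4 : T.card = 4 := by
        rw [hTdef, Finset.card_insert_of_notMem, Finset.card_insert_of_notMem,
          Finset.card_insert_of_notMem, Finset.card_singleton] <;>
          simp [hab.ne, hab.ne', hbc.ne, hcd.ne, hda.ne, hda.ne', hac, hac.symm, hbd]
      have h2 := card_nearDarts_le hdeg hx
      have h4 := card_nearEdges_le_card_nearDarts (G := G) a x
      have h5 := card_nearKeys_le_card_nearEdges (G := G) (precolor M N) a x
      omega
  by_cases hu : u = a
  · subst hu
    exact near v huv hT
  by_cases hv : v = a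
  · subst hv
    exact slack_comm (near u huv.symm (by rwa [Sym2.eq_swap]))
  refine slack_of_far hG hdeg (a := a)
    (fun w y y' _ _ => precolor_endpoint_unique hMN w y y') (fun f hf => ?_) huv hu hv
  by_cases hfT : f ∈ T
  · exact rlt _ hT f hfT
  · have h1 : f ≠ s(a, b) := by rintro rfl; simp [hTdef] at hfT
    have h2 : s(u, v) ≠ s(a, b) := by intro h; simp [hTdef, h] at hT
    simp only [r, if_neg hT, if_neg hfT, if_neg h1, if_neg h2]
    omega

end Kernels

section FourCycles

variable {V : Type*} {G : SimpleGraph V}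

/-- `a`, `b`, `c`, `d` are the consecutive vertices of a 4-cycle. -/
structure IsFourCycle (G : SimpleGraph V) (a b c d : V) : Prop where
  ab : G.Adj a b
  bc : G.Adj b c
  cd : G.Adj c d
  da : G.Adj d a
  ac : a ≠ c
  bd : b ≠ d

lemma IsFourCycle.rotate {a b c d : V} (h : IsFourCycle G a b c d) : IsFourCycle G b c d a :=
  ⟨h.bc, h.cd, h.da, h.ab, h.bd, h.ac.symm⟩

/-- Some edge at `a` and some edge at `c` are not near each other. -/
def HasFarEdges (G : SimpleGraph V) (a c : V) : Prop :=
  ∃ x z, G.Adj a x ∧ G.Adj c z ∧ ¬ G.Adj x c ∧ ¬ G.Adj z a ∧ ¬ G.Adj x z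

lemma not_edgesNear {a x c z : V} (hax : G.Adj a x) (hac : ¬ G.Adj a c)
    (hxc : ¬ G.Adj x c) (hza : ¬ G.Adj z a) (hxz : ¬ G.Adj x z) :
    ¬ EdgesNear G s(a, x) s(c, z) := by
  unfold EdgesNear
  simp only [Sym2.mem_iff]
  grind [G.adj_comm]

lemma apart_empty : Apart G ∅ := by
  intro e he
  simp at he

lemma edgesDisjoint_singleton (e : Sym2 V) : EdgesDisjoint {e} := by
  intro f hf g hg x _ _
  rw [Finset.mem_singleton] at hf hg
  rw [hf, hg]

lemma TriangleFree.ne_of_adj (htf : TriangleFree G) {u v x y : V} (huv : G.Adj u v)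
    (hux : G.Adj u x) (hvy : G.Adj v y) : x ≠ y := by
  rintro rfl
  exact htf _ _ _ huv hvy hux

/-- A 4-cycle `abcd` with pendant edges `ax`, `by`, `cz`, `dt` such that `ax`, `cz` are not near
each other, and neither are `by`, `dt`. -/
structure IsFramed (G : SimpleGraph V) (a b c d x y z t : V) : Prop extends
    IsFourCycle G a b c d where
  ax : G.Adj a x
  byy : G.Adj b y
  cz : G.Adj c z
  dt : G.Adj d t
  xc : ¬ G.Adj x c
  za : ¬ G.Adj z a
  xz : ¬ G.Adj x z
  yd : ¬ G.Adj y d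
  tb : ¬ G.Adj t b
  yt : ¬ G.Adj y t

lemma IsFramed.rotate {a b c d x y z t : V} (h : IsFramed G a b c d x y z t) :
    IsFramed G b c d a y z t x :=
  ⟨h.toIsFourCycle.rotate, h.byy, h.cz, h.dt, h.ax, h.yd, h.tb, h.yt, h.za, h.xc,
    fun hzx => h.xz hzx.symm⟩

variable [DecidableEq V]

lemma apart_insert {e : Sym2 V} {M : Finset (Sym2 V)} (hM : Apart G M)
    (he : ∀ f ∈ M, ¬ EdgesNear G e f) : Apart G (insert e M) := by
  intro f hf g hg hne
  rw [Finset.mem_insert] at hf hg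
  rcases hf with rfl | hf <;> rcases hg with rfl | hg
  · exact absurd rfl hne
  · exact he g hg
  · exact fun h => he f hf (edgesNear_symm h)
  · exact hM f hf g hg hne

lemma apart_pair {e f : Sym2 V} (h : ¬ EdgesNear G e f) : Apart G {e, f} :=
  apart_insert (M := {f}) (apart_insert (M := ∅) apart_empty (by simp)) (by simpa using h)

lemma edgesDisjoint_insert {u v : V} {M : Finset (Sym2 V)} (hM : EdgesDisjoint M)
    (h : ∀ f ∈ M, u ∉ f ∧ v ∉ f) : EdgesDisjoint (insert s(u, v) M) := by
  intro e he f hf x hxe hxf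
  rw [Finset.mem_insert] at he hf
  rcases he with rfl | he <;> rcases hf with rfl | hf
  · rfl
  · have := h f hf
    rw [Sym2.mem_iff] at hxe
    grind
  · have := h e he
    rw [Sym2.mem_iff] at hxf
    grind
  · exact hM e he f hf x hxe hxf

lemma IsFramed.card_eq (htf : TriangleFree G) {a b c d x y z t : V}
    (h : IsFramed G a b c d x y z t) :
    ({s(a, x), s(c, z), s(b, y), s(d, t)} : Finset (Sym2 V)).card = 4 := by
  obtain ⟨⟨h1, h2, h3, h4, h5, h6⟩, hax, hby, hcz, hdt, hxc, hza, hxz, hyd, htb, hyt⟩ := h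
  have nac : ¬ G.Adj a c := htf _ _ _ h1 h2
  have nbd : ¬ G.Adj b d := htf _ _ _ h2 h3
  have xy : x ≠ y := htf.ne_of_adj h1 hax hby
  have yz : y ≠ z := htf.ne_of_adj h2 hby hcz
  have zt : z ≠ t := htf.ne_of_adj h3 hcz hdt
  have tx : t ≠ x := htf.ne_of_adj h4 hdt hax
  have := h1.ne
  have := h2.ne
  have := h3.ne
  have := h4.ne
  rw [Finset.card_insert_of_notMem, Finset.card_insert_of_notMem,
    Finset.card_insert_of_notMem, Finset.card_singleton] <;>
    simp only [Finset.mem_insert, Finset.mem_singleton, Sym2.eq_iff] <;>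
    grind [G.adj_comm]

lemma IsFramed.edgesDisjoint (htf : TriangleFree G) {a b c d x y z t : V}
    (h : IsFramed G a b c d x y z t) :
    EdgesDisjoint ({s(a, x), s(c, z), s(b, y), s(d, t)} : Finset (Sym2 V)) := by
  obtain ⟨⟨h1, h2, h3, h4, h5, h6⟩, hax, hby, hcz, hdt, hxc, hza, hxz, hyd, htb, hyt⟩ := h
  have nac : ¬ G.Adj a c := htf _ _ _ h1 h2
  have nbd : ¬ G.Adj b d := htf _ _ _ h2 h3
  have xy : x ≠ y := htf.ne_of_adj h1 hax hby
  have yz : y ≠ z := htf.ne_of_adj h2 hby hcz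
  have zt : z ≠ t := htf.ne_of_adj h3 hcz hdt
  have tx : t ≠ x := htf.ne_of_adj h4 hdt hax
  have := h1.ne
  have := h2.ne
  have := h3.ne
  have := h4.ne
  refine edgesDisjoint_insert (edgesDisjoint_insert (edgesDisjoint_insert
    (edgesDisjoint_singleton _) ?_) ?_) ?_ <;>
    simp only [Finset.mem_insert, Finset.mem_singleton, forall_eq_or_imp, forall_eq,
      Sym2.mem_iff] <;>
    grind [G.adj_comm]

variable [Fintype V] [DecidableRel G.Adj]

theorem exists_coloring_of_card_squares (hG : G.Connected) (hdeg : ∀ x, G.degree x ≤ 5)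
    (htf : TriangleFree G) {a b c d : V} (h : IsFourCycle G a b c d)
    (hab : 4 ≤ (squares G a b).card) (hbc : 3 ≤ (squares G b c).card)
    (hcd : 3 ≤ (squares G c d).card) (hda : 3 ≤ (squares G d a).card) :
    ∃ c : G.edgeSet → Fin 37, IsStrongEdgeColoring G c := by
  have k : ∀ u v, G.Adj u v →
      (nearKeys G (precolor ∅ ∅) u v).card + (squares G u v).card ≤ 40 := by
    intro u v huv
    have h1 := card_nearKeys_le_card_nearEdges (G := G) (precolor ∅ ∅) u v
    have h2 := card_nearEdges_add_card_squares_le hdeg htf huv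
    omega
  have k1 := k _ _ h.ab
  have k2 := k _ _ h.bc
  have k3 := k _ _ h.cd
  have k4 := k _ _ h.da
  exact exists_coloring_of_cycle hG hdeg h.ab h.bc h.cd h.da h.ac h.bd
    (M := ∅) (N := ∅) apart_empty apart_empty (by intro e he; simp at he) (by simp)
    (by omega) (by omega) (by omega) (by omega)

theorem exists_coloring_of_hasFarEdges (hG : G.Connected) (hdeg : ∀ x, G.degree x ≤ 5)
    (htf : TriangleFree G) {a b c d : V} (h : IsFourCycle G a b c d) (hac : HasFarEdges G a c)
    (hab : 3 ≤ (squares G a b).card) (hbc : 2 ≤ (squares G b c).card)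
    (hcd : 2 ≤ (squares G c d).card) (hda : 2 ≤ (squares G d a).card) :
    ∃ c : G.edgeSet → Fin 37, IsStrongEdgeColoring G c := by
  obtain ⟨x, z, hax, hcz, hxc, hza, hxz⟩ := hac
  obtain ⟨h1, h2, h3, h4, h5, h6⟩ := h
  have nac : ¬ G.Adj a c := htf _ _ _ h1 h2
  have xb : x ≠ b := by rintro rfl; exact hxc h2
  have xd : x ≠ d := by rintro rfl; exact hxc h3.symm
  have zb : z ≠ b := by rintro rfl; exact hza h1.symm
  have zd : z ≠ d := by rintro rfl; exact hza h4
  have az : a ≠ z := by rintro rfl; exact nac hcz.symm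
  have cx : c ≠ x := by rintro rfl; exact nac hax
  let M : Finset (Sym2 V) := {s(a, x), s(c, z)}
  have hMc : M.card = 2 := Finset.card_pair (by simp [h5, az])
  have k : ∀ u v, G.Adj u v → M ⊆ nearEdges G u v →
      (nearKeys G (precolor M ∅) u v).card + (squares G u v).card ≤ 39 := by
    intro u v huv hsub
    have h1 := card_nearKeys_precolor_empty_add_card_le (M := M) subset_rfl hsub
    have h2 := card_nearEdges_add_card_squares_le hdeg htf huv
    omega
  have k1 := k _ _ h1 <| by
    simp only [M, Finset.insert_subset_iff, Finset.singleton_subset_iff]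
    exact ⟨Sym2.eq_swap (a := x) ▸ mem_nearEdges_of_left hax xb hax.symm,
      mem_nearEdges_of_right h2 h5.symm hcz⟩
  have k2 := k _ _ h2 <| by
    simp only [M, Finset.insert_subset_iff, Finset.singleton_subset_iff]
    exact ⟨mem_nearEdges_of_left h1.symm h5 hax,
      Sym2.eq_swap (a := z) ▸ mem_nearEdges_of_right hcz zb hcz.symm⟩
  have k3 := k _ _ h3 <| by
    simp only [M, Finset.insert_subset_iff, Finset.singleton_subset_iff]
    exact ⟨mem_nearEdges_of_right h4 h5 hax,
      Sym2.eq_swap (a := z) ▸ mem_nearEdges_of_left hcz zd hcz.symm⟩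
  have k4 := k _ _ h4 <| by
    simp only [M, Finset.insert_subset_iff, Finset.singleton_subset_iff]
    exact ⟨Sym2.eq_swap (a := x) ▸ mem_nearEdges_of_right hax xd hax.symm,
      mem_nearEdges_of_left h3.symm h5.symm hcz⟩
  refine exists_coloring_of_cycle hG hdeg h1 h2 h3 h4 h5 h6 (M := M) (N := ∅)
    (apart_pair (not_edgesNear hax nac hxc hza hxz)) apart_empty ?_ ?_
    (by omega) (by omega) (by omega) (by omega)
  · rw [Finset.union_empty]
    refine edgesDisjoint_insert (edgesDisjoint_singleton _) ?_
    have : x ≠ z := by rintro rfl; exact hxc hcz.symm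
    simp [h5, az, cx.symm, this]
  · simp only [M, Finset.mem_insert, Finset.mem_singleton, Finset.union_empty]
    have := h1.ne
    have := h2.ne
    have := h3.ne
    have := h4.ne
    rintro e (rfl | rfl | rfl | rfl) <;> simp only [Sym2.eq_iff] <;> grind

lemma IsFramed.subset_nearEdges {a b c d x y z t : V} (h : IsFramed G a b c d x y z t) :
    {s(a, x), s(c, z), s(b, y), s(d, t)} ⊆ nearEdges G a b := by
  obtain ⟨⟨h1, h2, h3, h4, h5, h6⟩, hax, hby, hcz, hdt, hxc, hza, hxz, hyd, htb, hyt⟩ := h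
  simp only [Finset.insert_subset_iff, Finset.singleton_subset_iff]
  refine ⟨Sym2.eq_swap (a := x) ▸ mem_nearEdges_of_left hax ?_ hax.symm,
    mem_nearEdges_of_right h2 h5.symm hcz,
    Sym2.eq_swap (a := y) ▸ mem_nearEdges_of_right hby ?_ hby.symm,
    mem_nearEdges_of_left h4.symm h6.symm hdt⟩
  · rintro rfl
    exact hxc h2
  · rintro rfl
    exact hyd h4.symm

theorem IsFramed.exists_coloring (hG : G.Connected) (hdeg : ∀ x, G.degree x ≤ 5)
    (htf : TriangleFree G) {a b c d x y z t : V} (h : IsFramed G a b c d x y z t)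
    {M N : Finset (Sym2 V)} (hsub : {s(a, x), s(c, z), s(b, y), s(d, t)} ⊆ M ∪ N)
    (hM : Apart G M) (hN : Apart G N) (hMN : EdgesDisjoint (M ∪ N))
    (kab : (nearKeys G (precolor M N) a b).card ≤ 36) :
    ∃ c : G.edgeSet → Fin 37, IsStrongEdgeColoring G c := by
  have k : ∀ {a b c d x y z t}, IsFramed G a b c d x y z t →
      {s(a, x), s(c, z), s(b, y), s(d, t)} ⊆ M ∪ N →
      (nearKeys G (precolor M N) a b).card ≤ 37 := by
    intro a b c d x y z t h hsub
    have k1 := card_nearKeys_precolor_add_card_le hsub h.subset_nearEdges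
    have k2 := card_nearEdges_add_card_squares_le hdeg htf h.ab
    have k3 : 0 < (squares G a b).card :=
      Finset.card_pos.2 ⟨(d, c), mem_squares.2 (by
        simp [h.da.symm, h.bd.symm, h.bc, h.ac.symm, h.cd.symm])⟩
    have k4 := h.card_eq htf
    omega
  have sub : ∀ {e}, e ∈ ({s(a, x), s(c, z), s(b, y), s(d, t)} : Finset (Sym2 V)) →
      e ∈ M ∪ N := fun he => hsub he
  have out : ∀ {a b x : V}, b ≠ x → s(a, x) ∈ M ∪ N → s(a, b) ∉ M ∪ N := by
    intro a b x hbx h1 h2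
    have := hMN _ h1 _ h2 a (by simp) (by simp)
    simp only [Sym2.congr_right] at this
    exact hbx this.symm
  have perm : ∀ {e}, e ∈ ({s(b, y), s(d, t), s(c, z), s(a, x)} : Finset (Sym2 V)) →
      e ∈ M ∪ N := fun he => hsub (by
        simp only [Finset.mem_insert, Finset.mem_singleton] at he ⊢
        tauto)
  refine exists_coloring_of_cycle hG hdeg h.ab h.bc h.cd h.da h.ac h.bd hM hN hMN ?_ kab
    (k h.rotate fun e he => perm he)
    (k h.rotate.rotate fun e he => sub ?_) (k h.rotate.rotate.rotate fun e he => sub ?_)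
  · simp only [Finset.mem_insert, Finset.mem_singleton]
    rintro e (rfl | rfl | rfl | rfl)
    · exact out (x := x) (by rintro rfl; exact h.xc h.bc) (sub (by simp))
    · exact out (x := y) (by rintro rfl; exact h.yd h.cd) (sub (by simp))
    · exact out (x := z) (by rintro rfl; exact h.za h.da) (sub (by simp))
    · exact out (x := t) (by rintro rfl; exact h.tb h.ab) (sub (by simp))
  all_goals
    simp only [Finset.mem_insert, Finset.mem_singleton] at he ⊢
    tauto

theorem IsFramed.exists_coloring_of_card_squares (hG : G.Connected)
    (hdeg : ∀ x, G.degree x ≤ 5) (htf : TriangleFree G) {a b c d x y z t : V}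
    (h : IsFramed G a b c d x y z t) (hab : 2 ≤ (squares G a b).card) :
    ∃ c : G.edgeSet → Fin 37, IsStrongEdgeColoring G c := by
  have nac : ¬ G.Adj a c := htf _ _ _ h.ab h.bc
  have nbd : ¬ G.Adj b d := htf _ _ _ h.bc h.cd
  have hsub : {s(a, x), s(c, z), s(b, y), s(d, t)} ⊆
      ({s(a, x), s(c, z)} ∪ {s(b, y), s(d, t)} : Finset (Sym2 V)) := by
    intro e he
    simp only [Finset.mem_union, Finset.mem_insert, Finset.mem_singleton] at he ⊢
    tauto
  have h2 := card_nearEdges_add_card_squares_le hdeg htf h.ab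
  have h1 := card_nearKeys_precolor_add_card_le hsub h.subset_nearEdges
  rw [h.card_eq htf] at h1
  refine h.exists_coloring hG hdeg htf hsub
    (apart_pair (not_edgesNear h.ax nac h.xc h.za h.xz))
    (apart_pair (not_edgesNear h.byy nbd h.yd h.tb h.yt)) ?_ (by omega)
  convert h.edgesDisjoint htf using 1
  ext e
  simp only [Finset.mem_union, Finset.mem_insert, Finset.mem_singleton]
  tauto

lemma IsFourCycle.mem_squares {a b c d : V} (h : IsFourCycle G a b c d) : (d, c) ∈ squares G a b :=
  StrongEdgeColoring.mem_squares.2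
    (by simp [h.da.symm, h.bd.symm, h.bc, h.ac.symm, h.cd.symm])

lemma IsFourCycle.eq_of_card_squares_le_one
    (hsq : ∀ u v, G.Adj u v → (squares G u v).card ≤ 1) {a b c d c' d' : V}
    (h : IsFourCycle G a b c d) (h' : IsFourCycle G a b c' d') : c = c' ∧ d = d' := by
  have := Finset.card_le_one.1 (hsq a b h.ab) _ h.mem_squares _ h'.mem_squares
  simpa [and_comm] using this

/-- At most one vertex other than `a` has two neighbors in a set of three neighbors of `a`. -/
lemma card_filter_le_one_of_card_squares_le_one
    (hsq : ∀ u v, G.Adj u v → (squares G u v).card ≤ 1) {a : V} {X Q : Finset V}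
    (hX : ∀ x ∈ X, G.Adj a x) (hX3 : X.card ≤ 3) (hQ : a ∉ Q) :
    (Q.filter fun q => 2 ≤ (X.filter fun x => G.Adj q x).card).card ≤ 1 := by
  rw [Finset.card_le_one]
  intro q hq q' hq'
  rw [Finset.mem_filter] at hq hq'
  have h1 := Finset.card_union_add_card_inter (X.filter fun x => G.Adj q x)
    (X.filter fun x => G.Adj q' x)
  have h2 : (X.filter (fun x => G.Adj q x) ∪ X.filter fun x => G.Adj q' x).card ≤ X.card :=
    Finset.card_le_card (Finset.union_subset (Finset.filter_subset _ _) (Finset.filter_subset _ _))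
  obtain ⟨x, hx⟩ := Finset.card_pos.1 (show 0 < (X.filter (fun x => G.Adj q x) ∩
    X.filter fun x => G.Adj q' x).card by omega)
  simp only [Finset.mem_inter, Finset.mem_filter] at hx
  obtain ⟨x₁, hx₁, hne₁⟩ := Finset.exists_mem_ne (Nat.lt_of_succ_le hq.2) x
  obtain ⟨x₂, hx₂, hne₂⟩ := Finset.exists_mem_ne (Nat.lt_of_succ_le hq'.2) x
  rw [Finset.mem_filter] at hx₁ hx₂
  have c₁ : IsFourCycle G a x q x₁ := ⟨hX x hx.1.1, hx.1.2.symm, hx₁.2, (hX x₁ hx₁.1).symm,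
    by rintro rfl; exact hQ hq.1, hne₁.symm⟩
  have c₂ : IsFourCycle G a x q' x₂ := ⟨hX x hx.1.1, hx.2.2.symm, hx₂.2, (hX x₂ hx₂.1).symm,
    by rintro rfl; exact hQ hq'.1, hne₂.symm⟩
  exact (c₁.eq_of_card_squares_le_one hsq c₂).1

lemma card_neighborFinset_sdiff_pair {a b d : V} (hab : G.Adj a b) (had : G.Adj a d)
    (hbd : b ≠ d) : (G.neighborFinset a \ {b, d}).card + 2 = G.degree a := by
  rw [← Finset.card_pair hbd, ← G.card_neighborFinset_eq_degree]
  refine Finset.card_sdiff_add_card_eq_card ?_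
  simp [Finset.insert_subset_iff, hab, had]

/-- If an edge `y'q` with `y'` adjacent to `b` is not near `ax` and `cz`, it can be given their
color. -/
theorem IsFramed.exists_coloring_of_extra (hG : G.Connected)
    (hdeg : ∀ x, G.degree x ≤ 5) (htf : TriangleFree G) {a b c d x y z t y' q : V}
    (hF : IsFramed G a b c d x y z t) (hby' : G.Adj b y') (hy'q : G.Adj y' q) (hy'a : y' ≠ a)
    (hy'c : y' ≠ c) (hy'y : y' ≠ y) (hy'd : ¬ G.Adj y' d) (qb : q ≠ b) (qt : q ≠ t)
    (hxy' : ¬ G.Adj x y') (hzy' : ¬ G.Adj z y') (hqa : ¬ G.Adj q a) (hqc : ¬ G.Adj q c)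
    (hqx : ¬ G.Adj q x) (hqz : ¬ G.Adj q z) :
    ∃ c : G.edgeSet → Fin 37, IsStrongEdgeColoring G c := by
  obtain ⟨h, hax, hby, hcz, hdt, hxc, hza, hxz, hyd, htb, hyt⟩ := id hF
  have hab := h.ab
  have hbc := h.bc
  have nac : ¬ G.Adj a c := htf _ _ _ hab hbc
  have nbd : ¬ G.Adj b d := htf _ _ _ hbc h.cd
  have ny'a : ¬ G.Adj y' a := fun hh => htf _ _ _ hby' hh hab.symm
  have ny'c : ¬ G.Adj y' c := fun hh => htf _ _ _ hby' hh hbc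
  have hx_y : x ≠ y' := htf.ne_of_adj hab hax hby'
  have hz_y : z ≠ y' := htf.ne_of_adj hbc.symm hcz hby'
  have hy_q : y ≠ q := by rintro rfl; exact htf _ _ _ hby' hy'q hby
  have hout : ∀ f ∈ ({s(a, x), s(c, z), s(b, y), s(d, t)} : Finset (Sym2 V)),
      y' ∉ f ∧ q ∉ f := by
    simp only [Finset.mem_insert, Finset.mem_singleton, forall_eq_or_imp, forall_eq,
      Sym2.mem_iff, not_or]
    refine ⟨⟨⟨hy'a, hx_y.symm⟩, ?_, by rintro rfl; exact hxy' hy'q.symm⟩,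
      ⟨⟨hy'c, hz_y.symm⟩, ?_, ?_⟩,
      ⟨⟨hby'.ne', hy'y⟩, qb, hy_q.symm⟩, ⟨?_, ?_⟩, ?_, qt⟩
    · rintro rfl; exact ny'a hy'q
    · rintro rfl; exact ny'c hy'q
    · rintro rfl; exact hzy' hy'q.symm
    · rintro rfl; exact nbd hby'
    · rintro rfl; exact htb hby'.symm
    · rintro rfl; exact hy'd hy'q
  have hset : ({s(y', q), s(a, x), s(c, z)} ∪ {s(b, y), s(d, t)} : Finset (Sym2 V)) =
      insert s(y', q) {s(a, x), s(c, z), s(b, y), s(d, t)} := by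
    ext e
    simp only [Finset.mem_union, Finset.mem_insert, Finset.mem_singleton]
    tauto
  have hnear : insert s(y', q) {s(a, x), s(c, z), s(b, y), s(d, t)} ⊆ nearEdges G a b :=
    Finset.insert_subset (mem_nearEdges_of_right hby' hy'a hy'q) hF.subset_nearEdges
  have k1 := card_nearKeys_precolor_add_card_le hset.ge hnear
  have k2 := card_nearEdges_add_card_squares_le hdeg htf hab
  have k3 := Finset.card_pos.2 ⟨_, h.mem_squares⟩
  rw [Finset.card_insert_of_notMem (fun hh => (hout _ hh).1 (by simp)), hF.card_eq htf] at k1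
  refine hF.exists_coloring hG hdeg htf (hset ▸ Finset.subset_insert _ _)
    (apart_insert (apart_pair (not_edgesNear hax nac hxc hza hxz)) ?_)
    (apart_pair (not_edgesNear hby nbd hyd htb hyt))
    (hset ▸ edgesDisjoint_insert (hF.edgesDisjoint htf) hout) (by omega)
  simp only [Finset.mem_insert, Finset.mem_singleton, forall_eq_or_imp, forall_eq]
  exact ⟨not_edgesNear hy'q ny'a hqa hxy' hqx, not_edgesNear hy'q ny'c hqc hzy' hqz⟩

theorem exists_coloring_of_card_squares_le_one (hG : G.Connected) (hreg : ∀ x, G.degree x = 5)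
    (htf : TriangleFree G) (hsq : ∀ u v, G.Adj u v → (squares G u v).card ≤ 1) {a b c d : V}
    (h : IsFourCycle G a b c d) (hbd : HasFarEdges G b d) :
    ∃ c : G.edgeSet → Fin 37, IsStrongEdgeColoring G c := by
  have hdeg : ∀ x, G.degree x ≤ 5 := fun x => (hreg x).le
  obtain ⟨y, t, hby, hdt, hyd, htb, hyt⟩ := hbd
  have hab := h.ab
  have hbc := h.bc
  have hcd := h.cd
  have hda := h.da
  have hac := h.ac
  have nac : ¬ G.Adj a c := htf _ _ _ hab hbc
  have nbd : ¬ G.Adj b d := htf _ _ _ hbc hcd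
  obtain ⟨y', hy'⟩ : (G.neighborFinset b \ {a, c, y}).Nonempty := by
    rw [← Finset.card_pos]
    have h1 := Finset.le_card_sdiff {a, c, y} (G.neighborFinset b)
    have h2 := Finset.card_le_three (a := a) (b := c) (c := y)
    rw [G.card_neighborFinset_eq_degree, hreg] at h1
    omega
  simp only [Finset.mem_sdiff, mem_neighborFinset, Finset.mem_insert, Finset.mem_singleton,
    not_or] at hy'
  obtain ⟨hby', hy'a, hy'c, hy'y⟩ := hy'
  have hy'd : ¬ G.Adj y' d := fun hh => hy'c
    (h.eq_of_card_squares_le_one hsq (c' := y') (d' := d)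
      ⟨hab, hby', hh, hda, Ne.symm hy'a, h.bd⟩).1.symm
  set X := G.neighborFinset a \ {b, d} with hX
  set Z := G.neighborFinset c \ {b, d} with hZ
  set Q := G.neighborFinset y' \ {b, t} with hQ
  have cX := card_neighborFinset_sdiff_pair hab hda.symm h.bd
  have cZ := card_neighborFinset_sdiff_pair hbc.symm hcd h.bd
  have cQ := Finset.le_card_sdiff {b, t} (G.neighborFinset y')
  rw [G.card_neighborFinset_eq_degree] at cQ
  have cbt := Finset.card_le_two (a := b) (b := t)
  rw [hreg] at cQ
  rw [hreg, ← hX] at cX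
  rw [hreg, ← hZ] at cZ
  rw [← hQ] at cQ
  have hXa : ∀ x ∈ X, G.Adj a x := by simp +contextual [hX]
  have hZc : ∀ x ∈ Z, G.Adj c x := by simp +contextual [hZ]
  have hQy : ∀ q ∈ Q, G.Adj y' q := by simp +contextual [hQ]
  have bX := card_filter_le_one_of_card_squares_le_one hsq hXa (Q := Q) (by omega)
    (fun hq => htf _ _ _ hab hby' (hQy a hq).symm)
  have bZ := card_filter_le_one_of_card_squares_le_one hsq hZc (Q := Q) (by omega)
    (fun hq => htf _ _ _ hbc.symm hby' (hQy c hq).symm)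
  obtain ⟨q, hq⟩ : (Q \ ((Q.filter fun q => 2 ≤ (X.filter fun x => G.Adj q x).card) ∪
      Q.filter fun q => 2 ≤ (Z.filter fun x => G.Adj q x).card)).Nonempty := by
    rw [← Finset.card_pos]
    have h1 := Finset.le_card_sdiff ((Q.filter fun q => 2 ≤ (X.filter fun x => G.Adj q x).card) ∪
      Q.filter fun q => 2 ≤ (Z.filter fun x => G.Adj q x).card) Q
    have h2 := Finset.card_union_le (Q.filter fun q => 2 ≤ (X.filter fun x => G.Adj q x).card)
      (Q.filter fun q => 2 ≤ (Z.filter fun x => G.Adj q x).card)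
    omega
  simp only [Finset.mem_sdiff, Finset.mem_union, Finset.mem_filter, not_or, not_and,
    not_le] at hq
  obtain ⟨hqQ, hqX, hqZ⟩ := hq
  have hy'q := hQy q hqQ
  have qb : q ≠ b := by rintro rfl; simp [hQ] at hqQ
  have qt : q ≠ t := by rintro rfl; simp [hQ] at hqQ
  have h1 := Finset.card_filter_add_card_filter_not (s := X) (fun x => G.Adj q x)
  have h2 := Finset.card_filter_add_card_filter_not (s := Z) (fun x => G.Adj q x)
  have h3 := hqX hqQ
  have h4 := hqZ hqQ
  obtain ⟨x₁, hx₁, x₂, hx₂, x12⟩ := Finset.one_lt_card.1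
    (show 1 < (X.filter fun x => ¬ G.Adj q x).card by omega)
  obtain ⟨z₁, hz₁, z₂, hz₂, z12⟩ := Finset.one_lt_card.1
    (show 1 < (Z.filter fun x => ¬ G.Adj q x).card by omega)
  obtain ⟨x, hx, z, hz, hxz⟩ : ∃ x ∈ X.filter (fun x => ¬ G.Adj q x),
      ∃ z ∈ Z.filter (fun x => ¬ G.Adj q x), ¬ G.Adj x z := by
    by_contra! hcon
    have ax₁ := hXa _ (Finset.mem_filter.1 hx₁).1
    have ax₂ := hXa _ (Finset.mem_filter.1 hx₂).1
    have cz₁ := hZc _ (Finset.mem_filter.1 hz₁).1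
    have cz₂ := hZc _ (Finset.mem_filter.1 hz₂).1
    have c₁ : IsFourCycle G x₁ z₁ x₂ z₂ := ⟨hcon _ hx₁ _ hz₁, (hcon _ hx₂ _ hz₁).symm,
      hcon _ hx₂ _ hz₂, (hcon _ hx₁ _ hz₂).symm, x12, z12⟩
    have c₂ : IsFourCycle G x₁ z₁ x₂ a := ⟨hcon _ hx₁ _ hz₁, (hcon _ hx₂ _ hz₁).symm,
      ax₂.symm, ax₁, x12, by rintro rfl; exact nac cz₁.symm⟩
    have := (c₁.eq_of_card_squares_le_one hsq c₂).2
    exact nac (this ▸ cz₂.symm)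
  simp only [hX, hZ, Finset.mem_filter, Finset.mem_sdiff, mem_neighborFinset, Finset.mem_insert,
    Finset.mem_singleton, not_or] at hx hz
  obtain ⟨⟨hax, xb, xd⟩, hqx⟩ := hx
  obtain ⟨⟨hcz, zb, zd⟩, hqz⟩ := hz
  have hcb : IsFourCycle G c b a d := ⟨hbc.symm, hab.symm, hda.symm, hcd.symm, hac.symm, h.bd⟩
  have hxc : ¬ G.Adj x c := fun hh => xd
    (h.eq_of_card_squares_le_one hsq ⟨hab, hbc, hh.symm, hax.symm, hac, Ne.symm xb⟩).2.symm
  have hza : ¬ G.Adj z a := fun hh => zd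
    (hcb.eq_of_card_squares_le_one hsq
      ⟨hbc.symm, hab.symm, hh.symm, hcz.symm, hac.symm, Ne.symm zb⟩).2.symm
  have hxy' : ¬ G.Adj x y' := fun hh => hy'c
    (h.eq_of_card_squares_le_one hsq
      ⟨hab, hby', hh.symm, hax.symm, Ne.symm hy'a, Ne.symm xb⟩).1.symm
  have hzy' : ¬ G.Adj z y' := fun hh => hy'a
    (hcb.eq_of_card_squares_le_one hsq
      ⟨hbc.symm, hby', hh.symm, hcz.symm, Ne.symm hy'c, Ne.symm zb⟩).1.symm
  have hqa : ¬ G.Adj q a := fun hh => hy'c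
    (h.eq_of_card_squares_le_one hsq ⟨hab, hby', hy'q, hh, Ne.symm hy'a, qb.symm⟩).1.symm
  have hqc : ¬ G.Adj q c := fun hh => hy'a
    (hcb.eq_of_card_squares_le_one hsq
      ⟨hbc.symm, hby', hy'q, hh, Ne.symm hy'c, qb.symm⟩).1.symm
  have hF : IsFramed G a b c d x y z t :=
    ⟨h, hax, hby, hcz, hdt, hxc, hza, hxz, hyd, htb, hyt⟩
  exact hF.exists_coloring_of_extra hG hdeg htf hby' hy'q hy'a hy'c hy'y hy'd qb qt
    hxy' hzy' hqa hqc
    hqx hqz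



lemma adj_of_not_hasFarEdges {a c x z : V} (h : ¬ HasFarEdges G a c)
    (hx : x ∈ G.neighborFinset a \ G.neighborFinset c)
    (hz : z ∈ G.neighborFinset c \ G.neighborFinset a) : G.Adj x z := by
  simp only [Finset.mem_sdiff, mem_neighborFinset] at hx hz
  by_contra hxz
  exact h ⟨x, z, hx.1, hz.1, fun hh => hx.2 hh.symm, fun hh => hz.2 hh.symm, hxz⟩

lemma card_neighborFinset_sdiff_add (hreg : ∀ x, G.degree x = 5) (a c : V) :
    (G.neighborFinset a \ G.neighborFinset c).card +
      (G.neighborFinset a ∩ G.neighborFinset c).card = 5 := by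
  rw [Finset.card_sdiff_add_card_inter, G.card_neighborFinset_eq_degree, hreg]

theorem exists_coloring_of_card_inter_eq_two (hG : G.Connected) (hreg : ∀ x, G.degree x = 5)
    (htf : TriangleFree G) {a b c d : V} (h : IsFourCycle G a b c d) (hac : ¬ HasFarEdges G a c)
    (hQ : (G.neighborFinset a ∩ G.neighborFinset c).card = 2) :
    ∃ c : G.edgeSet → Fin 37, IsStrongEdgeColoring G c := by
  have nac : ¬ G.Adj a c := htf _ _ _ h.ab h.bc
  have hA := card_neighborFinset_sdiff_add hreg a c
  have hC := card_neighborFinset_sdiff_add hreg c a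
  rw [Finset.inter_comm] at hC
  have hfull := fun x z => adj_of_not_hasFarEdges (x := x) (z := z) hac
  set A := G.neighborFinset a \ G.neighborFinset c with hAdef
  set C := G.neighborFinset c \ G.neighborFinset a with hCdef
  have hAa : ∀ x ∈ A, G.Adj a x := by simp +contextual [hAdef]
  have haC : a ∉ C := by simp [hCdef, G.adj_comm c a, nac]
  obtain ⟨x, hx, x', hx', hne⟩ := Finset.one_lt_card.1 (show 1 < A.card by omega)
  obtain ⟨z, hz⟩ := Finset.card_pos.1 (show 0 < C.card by omega)
  have hxA := Finset.card_erase_add_one hx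
  have hxA' := Finset.card_erase_add_one hx'
  have hzC := Finset.card_erase_add_one hz
  have sq_right : ∀ w ∈ A, 6 ≤ (squares G w a).card := by
    intro w hw
    refine le_trans ?_ (card_mul_card_le_card_squares C (A.erase w) ?_ ?_ ?_)
    · have := Finset.card_erase_add_one hw
      exact Nat.mul_le_mul (show 3 ≤ _ by omega) (show 2 ≤ _ by omega)
    · exact fun y hy => ⟨hfull _ _ hw hy, ne_of_mem_of_not_mem hy haC⟩
    · exact fun y hy => ⟨hAa y (Finset.mem_of_mem_erase hy), Finset.ne_of_mem_erase hy⟩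
    · exact fun u hu v hv => (hfull _ _ (Finset.mem_of_mem_erase hv) hu).symm
  have sq_left : ∀ w ∈ A, 4 ≤ (squares G w z).card := by
    intro w hw
    refine le_trans ?_ (card_mul_card_le_card_squares (C.erase z) (A.erase w) ?_ ?_ ?_)
    · have := Finset.card_erase_add_one hw
      exact Nat.mul_le_mul (show 2 ≤ _ by omega) (show 2 ≤ _ by omega)
    · exact fun y hy => ⟨hfull _ _ hw (Finset.mem_of_mem_erase hy), Finset.ne_of_mem_erase hy⟩
    · exact fun y hy => ⟨(hfull _ _ (Finset.mem_of_mem_erase hy) hz).symm,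
        Finset.ne_of_mem_erase hy⟩
    · exact fun u hu v hv =>
        (hfull _ _ (Finset.mem_of_mem_erase hv) (Finset.mem_of_mem_erase hu)).symm
  have h1 := sq_right x hx
  have h2 := sq_right x' hx'
  have h3 := sq_left x hx
  have h4 := sq_left x' hx'
  rw [card_squares_comm] at h1 h4
  exact exists_coloring_of_card_squares hG (fun x => (hreg x).le) htf
    (a := a) (b := x) (c := z) (d := x')
    ⟨hAa x hx, hfull _ _ hx hz, (hfull _ _ hx' hz).symm, (hAa x' hx').symm,
      (ne_of_mem_of_not_mem hz haC).symm, hne⟩ (by omega) (by omega) (by omega) (by omega)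

theorem exists_coloring_of_card_inter_eq_three (hG : G.Connected)
    (hreg : ∀ x, G.degree x = 5) (htf : TriangleFree G) {a b c d : V}
    (h : IsFourCycle G a b c d) (hac : ¬ HasFarEdges G a c)
    (hQ : (G.neighborFinset a ∩ G.neighborFinset c).card = 3) :
    ∃ c : G.edgeSet → Fin 37, IsStrongEdgeColoring G c := by
  have nac : ¬ G.Adj a c := htf _ _ _ h.ab h.bc
  have hA := card_neighborFinset_sdiff_add hreg a c
  have hC := card_neighborFinset_sdiff_add hreg c a
  rw [Finset.inter_comm] at hC
  have hfull := fun x z => adj_of_not_hasFarEdges (x := x) (z := z) hac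
  obtain ⟨x, hx, x', hx', hne⟩ := Finset.one_lt_card.1
    (show 1 < (G.neighborFinset a \ G.neighborFinset c).card by omega)
  obtain ⟨z, hz, z', hz', hne'⟩ := Finset.one_lt_card.1
    (show 1 < (G.neighborFinset c \ G.neighborFinset a).card by omega)
  have hxz := hfull _ _ hx hz
  have hxz' := hfull _ _ hx hz'
  have hx'z := hfull _ _ hx' hz
  have hx'z' := hfull _ _ hx' hz'
  clear hfull
  simp only [Finset.mem_sdiff, mem_neighborFinset] at hx hx' hz hz'
  have hza : z ≠ a := by rintro rfl; exact nac hz.1.symm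
  have hz'a : z' ≠ a := by rintro rfl; exact nac hz'.1.symm
  have hxc : x ≠ c := by rintro rfl; exact nac hx.1
  have hx'c : x' ≠ c := by rintro rfl; exact nac hx'.1
  have hcyc : IsFourCycle G z x a x' := ⟨hxz.symm, hx.1.symm, hx'.1, hx'z, hza, hne⟩
  by_cases hza' : HasFarEdges G z a
  · have s1 : ({(x', z'), (x', a), (c, z')} : Finset (V × V)) ⊆ squares G z x := by
      simp only [Finset.insert_subset_iff, Finset.singleton_subset_iff, mem_squares]
      exact ⟨⟨hx'z.symm, hne.symm, hxz', hne'.symm, hx'z'⟩,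
        ⟨hx'z.symm, hne.symm, hx.1.symm, hza.symm, hx'.1.symm⟩,
        ⟨hz.1.symm, hxc.symm, hxz', hne'.symm, hz'.1⟩⟩
    have s2 : ({z, z'} : Finset V).card * ({x'} : Finset V).card ≤ (squares G x a).card := by
      refine card_mul_card_le_card_squares _ _ ?_ ?_ ?_ <;>
        simp [*, hx'z.symm, hx'z'.symm, hne.symm]
    have s3 : ({x} : Finset V).card * ({z, z'} : Finset V).card ≤ (squares G a x').card := by
      refine card_mul_card_le_card_squares _ _ ?_ ?_ ?_ <;> simp [*]
    have s4 : ({z', a} : Finset V).card * ({x} : Finset V).card ≤ (squares G x' z).card := by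
      refine card_mul_card_le_card_squares _ _ ?_ ?_ ?_ <;>
        simp [*, hx'.1.symm, hza.symm, hne'.symm, hxz.symm, hxz'.symm]
    have s1' := Finset.card_le_card s1
    have c1 : ({(x', z'), (x', a), (c, z')} : Finset (V × V)).card = 3 :=
      Finset.card_eq_three.2 ⟨_, _, _, by simp [hz'a], by simp [hx'c], by simp [hx'c], rfl⟩
    rw [Finset.card_pair hne', Finset.card_singleton] at s2 s3
    rw [Finset.card_pair hz'a, Finset.card_singleton] at s4
    exact exists_coloring_of_hasFarEdges hG (fun x => (hreg x).le) htf hcyc hza'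
      (by omega) (by omega) (by omega) (by omega)
  · refine exists_coloring_of_card_inter_eq_two hG hreg htf hcyc hza' ?_
    have e : G.neighborFinset z ∩ G.neighborFinset a = G.neighborFinset a \ G.neighborFinset c := by
      have hsub : G.neighborFinset z ∩ G.neighborFinset a ⊆
          G.neighborFinset a \ G.neighborFinset c := by
        intro s hs
        simp only [Finset.mem_inter, mem_neighborFinset, Finset.mem_sdiff] at hs ⊢
        exact ⟨hs.2, fun hcs => htf _ _ _ hz.1 hs.1 hcs⟩
      have h2 : ({x, x'} : Finset V) ⊆ G.neighborFinset z ∩ G.neighborFinset a := by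
        simp [Finset.insert_subset_iff, hxz.symm, hx'z.symm, hx.1, hx'.1]
      have h3 := Finset.card_le_card h2
      rw [Finset.card_pair hne] at h3
      exact Finset.eq_of_subset_of_card_le hsub (by omega)
    rw [e]
    omega

theorem exists_coloring_of_not_hasFarEdges (hG : G.Connected)
    (hreg : ∀ x, G.degree x = 5) (htf : TriangleFree G) {a b c d : V}
    (h : IsFourCycle G a b c d) (hac : ¬ HasFarEdges G a c) :
    ∃ c : G.edgeSet → Fin 37, IsStrongEdgeColoring G c := by
  have hdeg : ∀ x, G.degree x ≤ 5 := fun x => (hreg x).le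
  have two_le : ∀ {a b c d : V}, IsFourCycle G a b c d →
      2 ≤ (G.neighborFinset a ∩ G.neighborFinset c).card := by
    intro a b c d h
    rw [← Finset.card_pair h.bd]
    refine Finset.card_le_card ?_
    simp [Finset.insert_subset_iff, h.ab, h.bc.symm, h.cd, h.da.symm]
  have hQ2 := two_le h
  have sq : ∀ u s w, G.Adj u s → G.Adj w s → u ≠ w →
      (G.neighborFinset u ∩ G.neighborFinset w).card ≤ (squares G u s).card + 1 := by
    intro u s w hus hws huw
    rw [← Finset.card_erase_add_one (a := s) (by simp [hus, hws])]
    have := card_mul_card_le_card_squares (G := G) (a := u) (b := s)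
      ((G.neighborFinset u ∩ G.neighborFinset w).erase s) {w} (by simp +contextual)
      (by simp [hws.symm, huw.symm]) (by simp +contextual [G.adj_comm])
    simpa using this
  have s1 := sq a b c h.ab h.bc.symm h.ac
  have s2 := sq c b a h.bc.symm h.ab h.ac.symm
  have s3 := sq c d a h.cd h.da.symm h.ac.symm
  have s4 := sq a d c h.da.symm h.cd h.ac
  rw [card_squares_comm] at s2 s4
  rw [Finset.inter_comm] at s2 s3
  obtain h2 | h3 | h4 | h5 : (G.neighborFinset a ∩ G.neighborFinset c).card = 2 ∨
      (G.neighborFinset a ∩ G.neighborFinset c).card = 3 ∨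
      (G.neighborFinset a ∩ G.neighborFinset c).card = 4 ∨
      5 ≤ (G.neighborFinset a ∩ G.neighborFinset c).card := by omega
  · exact exists_coloring_of_card_inter_eq_two hG hreg htf h hac h2
  · exact exists_coloring_of_card_inter_eq_three hG hreg htf h hac h3
  · by_cases hbd : HasFarEdges G b d
    · exact exists_coloring_of_hasFarEdges hG hdeg htf h.rotate hbd (by omega) (by omega)
        (by omega) (by omega)
    · have hbd2 := two_le h.rotate
      obtain hb | hb : (G.neighborFinset b ∩ G.neighborFinset d).card = 2 ∨
        2 < (G.neighborFinset b ∩ G.neighborFinset d).card := by omega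
      · exact exists_coloring_of_card_inter_eq_two hG hreg htf h.rotate hbd hb
      · obtain ⟨k, hk⟩ : ((G.neighborFinset b ∩ G.neighborFinset d) \ {a, c}).Nonempty := by
          rw [← Finset.card_pos]
          have h1 := Finset.le_card_sdiff {a, c} (G.neighborFinset b ∩ G.neighborFinset d)
          rw [Finset.card_pair h.ac] at h1
          omega
        simp only [Finset.mem_sdiff, Finset.mem_inter, mem_neighborFinset, Finset.mem_insert,
          Finset.mem_singleton, not_or] at hk
        have hsub : insert (d, k) (((G.neighborFinset a ∩ G.neighborFinset c).erase b) ×ˢ {c}) ⊆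
            squares G a b := by
          rw [Finset.insert_subset_iff]
          refine ⟨mem_squares.2 (by simp [h.da.symm, h.bd.symm, hk]), ?_⟩
          rintro ⟨s, w⟩ hs
          simp only [Finset.mem_product, Finset.mem_erase, Finset.mem_inter, mem_neighborFinset,
            Finset.mem_singleton] at hs
          obtain ⟨⟨hsb, has, hcs⟩, rfl⟩ := hs
          exact mem_squares.2 (by simp [has, hsb, h.bc, h.ac.symm, hcs.symm])
        have h1 := Finset.card_le_card hsub
        rw [Finset.card_insert_of_notMem (by simp [Ne.symm hk.2.2]), Finset.card_product,
          Finset.card_singleton, Finset.card_erase_of_mem (by simp [h.ab, h.bc.symm])] at h1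
        exact exists_coloring_of_card_squares hG hdeg htf h (by omega) (by omega) (by omega)
          (by omega)
  · exact exists_coloring_of_card_squares hG hdeg htf h (by omega) (by omega) (by omega) (by omega)

theorem IsFourCycle.exists_coloring (hG : G.Connected) (hreg : ∀ x, G.degree x = 5)
    (htf : TriangleFree G) {a b c d : V} (h : IsFourCycle G a b c d) :
    ∃ c : G.edgeSet → Fin 37, IsStrongEdgeColoring G c := by
  by_cases hsq : ∀ u v, G.Adj u v → (squares G u v).card ≤ 1
  · by_cases hbd : HasFarEdges G b d
    · exact exists_coloring_of_card_squares_le_one hG hreg htf hsq h hbd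
    · exact exists_coloring_of_not_hasFarEdges hG hreg htf h.rotate hbd
  push Not at hsq
  obtain ⟨u, v, huv, hsq⟩ := hsq
  obtain ⟨⟨y, x⟩, hxy⟩ := Finset.card_pos.1 (show 0 < (squares G u v).card by omega)
  obtain ⟨huy, hyv, hvx, hxu, hyx⟩ := StrongEdgeColoring.mem_squares.1 hxy
  have hcyc : IsFourCycle G u v x y := ⟨huv, hvx, hyx.symm, huy.symm, hxu.symm, hyv.symm⟩
  by_cases h1 : HasFarEdges G u x
  · by_cases h2 : HasFarEdges G v y
    · obtain ⟨p, r, hp⟩ := h1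
      obtain ⟨q, s, hq⟩ := h2
      exact IsFramed.exists_coloring_of_card_squares hG (fun x => (hreg x).le) htf
        (x := p) (z := r) (y := q) (t := s) ⟨hcyc, hp.1, hq.1, hp.2.1, hq.2.1, hp.2.2.1,
          hp.2.2.2.1, hp.2.2.2.2, hq.2.2.1, hq.2.2.2.1, hq.2.2.2.2⟩ hsq
    · exact exists_coloring_of_not_hasFarEdges hG hreg htf hcyc.rotate h2
  · exact exists_coloring_of_not_hasFarEdges hG hreg htf hcyc h1

end FourCycles

section Star

variable {V : Type*} {G : SimpleGraph V}

/-- No two vertices have two common neighbors. -/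
def FourCycleFree (G : SimpleGraph V) : Prop :=
  ∀ a b c d, ¬ IsFourCycle G a b c d

lemma FourCycleFree.eq_of_common (hff : FourCycleFree G) {a c b d : V} (hac : a ≠ c)
    (hab : G.Adj a b) (hcb : G.Adj c b) (had : G.Adj a d) (hcd : G.Adj c d) : b = d := by
  by_contra hbd
  exact hff a b c d ⟨hab, hcb.symm, hcd, had.symm, hac, hbd⟩

/-- Each `u ∈ S` is a neighbor of `v` and `φ u` is a further neighbor of `u`, these
further neighbors being pairwise nonadjacent. -/
structure IsPick (G : SimpleGraph V) (v : V) (φ : V → V) (S : Finset V) : Prop where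
  adj_root : ∀ u ∈ S, G.Adj v u
  adj : ∀ u ∈ S, G.Adj u (φ u)
  ne : ∀ u ∈ S, φ u ≠ v
  not_adj : ∀ u ∈ S, ∀ u' ∈ S, u ≠ u' → ¬ G.Adj (φ u) (φ u')

lemma eq_of_mem_pendants (htf : TriangleFree G) (hff : FourCycleFree G) {v u u' x x' w : V}
    (hu : G.Adj v u) (hu' : G.Adj v u') (hx : G.Adj u x) (hx' : G.Adj u' x') (hxv : x ≠ v)
    (hw : w ∈ s(u, x)) (hw' : w ∈ s(u', x')) : u = u' := by
  rw [Sym2.mem_iff] at hw hw'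
  rcases hw with rfl | rfl <;> rcases hw' with rfl | rfl
  · rfl
  · exact absurd hu (htf _ _ _ hu' hx')
  · exact absurd hu' (htf _ _ _ hu hx)
  · exact hff.eq_of_common (Ne.symm hxv) hu hx.symm hu' hx'.symm

lemma not_edgesNear_pendants (htf : TriangleFree G) (hff : FourCycleFree G) {v u u' x x' : V}
    (hne : u ≠ u') (hu : G.Adj v u) (hu' : G.Adj v u') (hx : G.Adj u x) (hx' : G.Adj u' x')
    (hxv : x ≠ v) (hxv' : x' ≠ v) (hxx : ¬ G.Adj x x') :
    ¬ EdgesNear G s(u, x) s(u', x') :=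
  not_edgesNear hx (htf _ _ _ hu.symm hu')
    (fun hh => hne (hff.eq_of_common (Ne.symm hxv) hu hx.symm hu' hh))
    (fun hh => hne (hff.eq_of_common (Ne.symm hxv') hu hh hu' hx'.symm)) hxx

variable [DecidableEq V]

lemma IsPick.apart (htf : TriangleFree G) (hff : FourCycleFree G) {v : V} {φ : V → V}
    {S : Finset V} (h : IsPick G v φ S) : Apart G (S.image fun u => s(u, φ u)) := by
  intro e he f hf hef
  rw [Finset.mem_image] at he hf
  obtain ⟨u, hu, rfl⟩ := he
  obtain ⟨u', hu', rfl⟩ := hf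
  have hne : u ≠ u' := by rintro rfl; exact hef rfl
  exact not_edgesNear_pendants htf hff hne (h.adj_root u hu) (h.adj_root u' hu') (h.adj u hu)
    (h.adj u' hu') (h.ne u hu) (h.ne u' hu') (h.not_adj u hu u' hu' hne)

lemma Apart.edgesDisjoint {M : Finset (Sym2 V)} (h : Apart G M) : EdgesDisjoint M := by
  intro e he f hf x hxe hxf
  by_contra hef
  exact h e he f hf hef (Or.inl ⟨x, hxe, hxf⟩)

lemma IsPick.card_image (htf : TriangleFree G) (hff : FourCycleFree G) {v : V} {φ : V → V}
    {S : Finset V} (h : IsPick G v φ S) : (S.image fun u => s(u, φ u)).card = S.card := by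
  refine Finset.card_image_of_injOn fun u hu u' hu' huu => ?_
  exact eq_of_mem_pendants htf hff (w := u) (h.adj_root u hu) (h.adj_root u' hu') (h.adj u hu)
    (h.adj u' hu') (h.ne u hu) (by simp) (huu ▸ by simp)

lemma IsPick.insert {v : V} {φ : V → V} {S : Finset V} (h : IsPick G v φ S) {u w : V}
    (hu : G.Adj v u) (huS : u ∉ S) (hw : G.Adj u w) (hwv : w ≠ v)
    (hS : ∀ s ∈ S, ¬ G.Adj w (φ s)) : IsPick G v (Function.update φ u w) (insert u S) := by
  have e : ∀ s ∈ S, Function.update φ u w s = φ s := fun s hs =>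
    Function.update_of_ne (ne_of_mem_of_not_mem hs huS) _ _
  constructor
  · simpa using ⟨hu, h.adj_root⟩
  · simpa [hw] using fun s hs => (e s hs).symm ▸ h.adj s hs
  · simpa [hwv] using fun s hs => (e s hs).symm ▸ h.ne s hs
  · intro s hs t ht hst
    rw [Finset.mem_insert] at hs ht
    rcases hs with rfl | hs <;> rcases ht with rfl | ht
    · exact absurd rfl hst
    · rw [e t ht, Function.update_self]
      exact hS t ht
    · rw [e s hs, Function.update_self]
      exact fun hh => hS s hs hh.symm
    · rw [e s hs, e t ht]
      exact h.not_adj s hs t ht hst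

variable [Fintype V] [DecidableRel G.Adj]

lemma exists_adj_not_adj (hreg : ∀ x, G.degree x = 5) (hff : FourCycleFree G) {u v : V}
    (X T : Finset V) (hT : u ∉ T) (hXT : X.card + T.card ≤ 3) :
    ∃ w, G.Adj u w ∧ w ≠ v ∧ w ∉ X ∧ ∀ t ∈ T, ¬ G.Adj w t := by
  have h1 : (T.biUnion fun t => G.neighborFinset u ∩ G.neighborFinset t).card ≤ T.card * 1 := by
    refine Finset.card_biUnion_le_card_mul _ _ _ fun t ht => ?_
    rw [Finset.card_le_one]
    intro p hp q hq
    simp only [Finset.mem_inter, mem_neighborFinset] at hp hq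
    exact hff.eq_of_common (ne_of_mem_of_not_mem ht hT).symm hp.1 hp.2 hq.1 hq.2
  have h2 := Finset.card_union_le (insert v X)
    (T.biUnion fun t => G.neighborFinset u ∩ G.neighborFinset t)
  have h3 := Finset.card_insert_le v X
  have h4 := Finset.le_card_sdiff
    (insert v X ∪ T.biUnion fun t => G.neighborFinset u ∩ G.neighborFinset t) (G.neighborFinset u)
  rw [G.card_neighborFinset_eq_degree, hreg] at h4
  obtain ⟨w, hw⟩ := Finset.card_pos.1 (show 0 < (G.neighborFinset u \
    (insert v X ∪ T.biUnion fun t => G.neighborFinset u ∩ G.neighborFinset t)).card by omega)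
  simp only [Finset.mem_sdiff, Finset.mem_union, Finset.mem_insert, Finset.mem_biUnion,
    Finset.mem_inter, mem_neighborFinset, not_or, not_exists, not_and] at hw
  exact ⟨w, hw.1, hw.2.1.1, hw.2.1.2, fun t ht hh => hw.2.2 t ht hw.1 hh.symm⟩

lemma IsPick.extend (hreg : ∀ x, G.degree x = 5) (htf : TriangleFree G) (hff : FourCycleFree G)
    {v : V} {φ : V → V} {S : Finset V} (h : IsPick G v φ S) (R : Finset V)
    (hR : ∀ u ∈ R, G.Adj v u) (hcard : (S ∪ R).card ≤ 4) :
    ∃ ψ, IsPick G v ψ (S ∪ R) ∧ ∀ u ∈ S, ψ u = φ u := by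
  induction R using Finset.induction_on with
  | empty => exact ⟨φ, by simpa using h, fun _ _ => rfl⟩
  | insert u R huR ih =>
    rw [Finset.union_insert] at hcard ⊢
    obtain ⟨ψ, hψ, hψφ⟩ := ih (fun s hs => hR s (Finset.mem_insert_of_mem hs))
      ((Finset.card_le_card (Finset.subset_insert _ _)).trans hcard)
    have hu := hR u (Finset.mem_insert_self _ _)
    by_cases huS : u ∈ S ∪ R
    · rw [Finset.insert_eq_of_mem huS]
      exact ⟨ψ, hψ, hψφ⟩
    rw [Finset.card_insert_of_notMem huS] at hcard
    obtain ⟨w, hw, hwv, -, hwT⟩ := exists_adj_not_adj hreg hff (u := u) (v := v) ∅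
      ((S ∪ R).image ψ) (by
        rw [Finset.mem_image]
        rintro ⟨s, hs, rfl⟩
        exact htf _ _ _ (hψ.adj_root s hs) (hψ.adj s hs) hu)
      (by have := Finset.card_image_le (s := S ∪ R) (f := ψ); simp; omega)
    refine ⟨_, hψ.insert hu huS hw hwv (by simpa using hwT), fun s hs => ?_⟩
    rw [Function.update_of_ne (by rintro rfl; exact huS (Finset.mem_union_left _ hs))]
    exact hψφ s hs

lemma mem_nearEdges_of_pendant {v y u w : V} (hy : G.Adj v y) (hu : G.Adj v u) (hw : G.Adj u w)
    (hwv : w ≠ v) : s(u, w) ∈ nearEdges G v y := by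
  by_cases huy : u = y
  · subst huy
    rw [Sym2.eq_swap]
    exact mem_nearEdges_of_right hw hwv hw.symm
  · exact mem_nearEdges_of_left hu huy hw

lemma IsPick.image_subset_nearEdges {v : V} {φ : V → V} {S : Finset V} (h : IsPick G v φ S)
    {y : V} (hy : G.Adj v y) : (S.image fun u => s(u, φ u)) ⊆ nearEdges G v y := by
  intro e he
  rw [Finset.mem_image] at he
  obtain ⟨u, hu, rfl⟩ := he
  exact mem_nearEdges_of_pendant hy (h.adj_root u hu) (h.adj u hu) (h.ne u hu)

/-- If all five edges of an induced matching at `v` get one color, then the edges at `v` can be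
colored last. -/
theorem IsPick.exists_coloring (hG : G.Connected) (hreg : ∀ x, G.degree x = 5)
    (htf : TriangleFree G) (hff : FourCycleFree G) {v : V} {φ : V → V} {S : Finset V}
    (h : IsPick G v φ S) (hS : S.card = 5) :
    ∃ c : G.edgeSet → Fin 37, IsStrongEdgeColoring G c := by
  have hdeg : ∀ x, G.degree x ≤ 5 := fun x => (hreg x).le
  set M := S.image fun u => s(u, φ u)
  have hM : Apart G M := h.apart htf hff
  refine exists_coloring_of_slack (properPrecoloring_precolor hM apart_empty) (edgeDist G v)
    fun x y hxy _ => ?_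
  have near : ∀ y, G.Adj v y → Slack G (precolor M ∅) (edgeDist G v) v y := by
    intro y hy
    refine ⟨∅, by simp, by simp, ?_⟩
    have h1 := card_nearKeys_precolor_empty_add_card_le subset_rfl
      (h.image_subset_nearEdges hy)
    rw [h.card_image htf hff, hS] at h1
    have h2 := card_nearDarts_le hdeg hy
    have h4 := card_nearEdges_le_card_nearDarts (G := G) v y
    rw [Finset.card_empty]
    change (nearKeys G (precolor M ∅) v y).card + 5 ≤ _ at h1
    omega
  by_cases hx : x = v
  · subst hx
    exact near y hxy
  by_cases hy : y = v
  · subst hy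
    exact slack_comm (near x hxy.symm)
  refine slack_of_far hG hdeg (fun w y y' _ _ => precolor_endpoint_unique ?_ w y y')
    (fun _ hf => hf) hxy hx hy
  rw [Finset.union_empty]
  exact hM.edgesDisjoint

/-- Some vertex at distance two from `v`, reached through `u₀`, has no neighbor reached through
`u₁`. -/
theorem exists_coloring_of_unsaturated (hG : G.Connected) (hreg : ∀ x, G.degree x = 5)
    (htf : TriangleFree G) (hff : FourCycleFree G) {v u₀ u₁ w : V} (hu₀ : G.Adj v u₀)
    (hu₁ : G.Adj v u₁) (hne : u₀ ≠ u₁) (hw : G.Adj u₀ w) (hwv : w ≠ v)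
    (hsep : ∀ s, G.Adj u₁ s → s ≠ v → ¬ G.Adj w s) :
    ∃ c : G.edgeSet → Fin 37, IsStrongEdgeColoring G c := by
  have h₀ : IsPick G v (fun _ => w) {u₀} :=
    ⟨by simpa using hu₀, by simpa using hw, by simpa using hwv, by simp +contextual⟩
  have hcard : ((G.neighborFinset v).erase u₁).card = 4 := by
    rw [Finset.card_erase_of_mem (by simpa using hu₁), G.card_neighborFinset_eq_degree, hreg]
  have hS : {u₀} ∪ (G.neighborFinset v).erase u₁ = (G.neighborFinset v).erase u₁ :=
    Finset.union_eq_right.2 (by simpa [hu₀] using hne)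
  obtain ⟨φ, hφ, hφ₀⟩ := h₀.extend hreg htf hff ((G.neighborFinset v).erase u₁)
    (by simp +contextual) (by rw [hS, hcard])
  rw [hS] at hφ
  have hφ₀ : φ u₀ = w := hφ₀ u₀ (by simp)
  have hmem : u₀ ∈ (G.neighborFinset v).erase u₁ := by simpa [hu₀] using hne
  obtain ⟨w₁, hw₁, hwv₁, -, hT⟩ := exists_adj_not_adj hreg hff (u := u₁) (v := v) ∅
    ((((G.neighborFinset v).erase u₁).erase u₀).image φ) (by
      rw [Finset.mem_image]
      rintro ⟨s, hs, hs'⟩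
      have := Finset.mem_of_mem_erase hs
      exact htf _ _ _ (hφ.adj_root s this) (hφ.adj s this) (hs' ▸ hu₁))
    (by
      have h1 := Finset.card_image_le (s := ((G.neighborFinset v).erase u₁).erase u₀) (f := φ)
      have h2 := Finset.card_erase_add_one hmem
      simp only [Finset.card_empty]
      omega)
  have hφ' := hφ.insert hu₁ (by simp) hw₁ hwv₁ (fun s hs => by
    by_cases hsu : s = u₀
    · rw [hsu, hφ₀]
      exact fun hh => hsep w₁ hw₁ hwv₁ hh.symm
    · exact hT _ (Finset.mem_image_of_mem _ (Finset.mem_erase.2 ⟨hsu, hs⟩)))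
  refine hφ'.exists_coloring hG hreg htf hff ?_
  rw [Finset.insert_erase (by simpa using hu₁), G.card_neighborFinset_eq_degree, hreg]

/-- Every vertex at distance two from `v` has, for each neighbor `u` of `v`, a neighbor reached
through `u`. -/
def Saturated (G : SimpleGraph V) (v : V) : Prop :=
  ∀ u u' w, G.Adj v u → G.Adj v u' → u ≠ u' → G.Adj u w → w ≠ v →
    ∃ s, G.Adj u' s ∧ s ≠ v ∧ G.Adj w s

lemma Saturated.exists_adj (hreg : ∀ x, G.degree x = 5) (htf : TriangleFree G)
    (hff : FourCycleFree G) {v u x y : V} (h : Saturated G v) (hu : G.Adj v u) (hx : G.Adj u x)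
    (hxv : x ≠ v) (hxy : G.Adj x y) (hyu : y ≠ u) : ∃ u', u' ≠ u ∧ G.Adj v u' ∧ G.Adj u' y := by
  by_contra! hcon
  have hex : ∀ u' ∈ (G.neighborFinset v).erase u, ∃ s, G.Adj u' s ∧ s ≠ v ∧ G.Adj x s := by
    intro u' hu'
    rw [Finset.mem_erase, mem_neighborFinset] at hu'
    exact h u u' x hu hu'.2 (Ne.symm hu'.1) hx hxv
  choose! f hf using hex
  have c1 := Finset.card_erase_add_one ((G.mem_neighborFinset v u).2 hu)
  have c2 := Finset.card_erase_add_one ((G.mem_neighborFinset x u).2 hx.symm)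
  have c3 := Finset.card_erase_add_one (s := (G.neighborFinset x).erase u) (a := y)
    (by simp [hyu, hxy])
  rw [G.card_neighborFinset_eq_degree, hreg] at c1 c2
  obtain ⟨p, hp, q, hq, hpq, hfpq⟩ := Finset.exists_ne_map_eq_of_card_lt_of_maps_to
    (s := (G.neighborFinset v).erase u) (t := ((G.neighborFinset x).erase u).erase y) (f := f)
    (by omega) (by
      intro u' hu'
      have h1 := hf u' hu'
      simp only [Finset.coe_erase, Finset.mem_coe, Set.mem_sdiff,
        Set.mem_singleton_iff, mem_neighborFinset] at hu' ⊢
      refine ⟨⟨h1.2.2, fun hh => ?_⟩, fun hh => ?_⟩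
      · exact htf _ _ _ hu.symm hu'.1 (hh ▸ h1.1.symm)
      · exact hcon u' hu'.2 hu'.1 (hh ▸ h1.1))
  have h1 := hf p hp
  have h2 := hf q hq
  rw [Finset.mem_erase, mem_neighborFinset] at hp hq
  exact hpq (hff.eq_of_common (Ne.symm h1.2.1) hp.2 h1.1.symm hq.2 (hfpq ▸ h2.1.symm))

theorem exists_coloring_of_saturated (hG : G.Connected) (hreg : ∀ x, G.degree x = 5)
    (htf : TriangleFree G) (hff : FourCycleFree G) {v : V} (hsat : Saturated G v) :
    ∃ c : G.edgeSet → Fin 37, IsStrongEdgeColoring G c := by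
  have hdeg : ∀ x, G.degree x ≤ 5 := fun x => (hreg x).le
  obtain ⟨u₀, hu₀, u₁, hu₁, hne⟩ := Finset.one_lt_card.1
    (show 1 < (G.neighborFinset v).card by rw [G.card_neighborFinset_eq_degree, hreg]; omega)
  rw [mem_neighborFinset] at hu₀ hu₁
  have hcard : ((G.neighborFinset v).erase u₁).card = 4 := by
    rw [Finset.card_erase_of_mem (by simpa using hu₁), G.card_neighborFinset_eq_degree, hreg]
  obtain ⟨φ, hφ, -⟩ := IsPick.extend (φ := id) (S := ∅) hreg htf hff
    (v := v) ⟨by simp, by simp, by simp, by simp⟩ ((G.neighborFinset v).erase u₁)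
    (by simp +contextual) (by rw [Finset.empty_union, hcard])
  rw [Finset.empty_union] at hφ
  have hmem : u₀ ∈ (G.neighborFinset v).erase u₁ := by simpa [hu₀] using hne
  have hφ₀ := hφ.adj u₀ hmem
  have hφ₀v := hφ.ne u₀ hmem
  obtain ⟨w₁, hw₁, hwv₁, -, -⟩ := exists_adj_not_adj hreg hff (u := u₁) (v := v) ∅ ∅ (by simp)
    (by simp)
  obtain ⟨w₀, hw₀, hwv₀, hw₀φ, hw01⟩ := exists_adj_not_adj hreg hff (u := u₀) (v := v)
    {φ u₀} {w₁} (by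
      rw [Finset.mem_singleton]
      rintro rfl
      exact htf _ _ _ hu₁ hw₁ hu₀)
    (by simp)
  rw [Finset.mem_singleton] at hw₀φ
  have hw01 := hw01 w₁ (by simp)
  set M := ((G.neighborFinset v).erase u₁).image fun u => s(u, φ u) with hMdef
  let N : Finset (Sym2 V) := {s(u₁, w₁), s(u₀, w₀)}
  have hM : Apart G M := hφ.apart htf hff
  have hMcard : M.card = 4 := (hφ.card_image htf hff).trans hcard
  have hN : Apart G N := apart_pair
    (not_edgesNear_pendants htf hff hne.symm hu₁ hu₀ hw₁ hw₀ hwv₁ hwv₀ fun hh => hw01 hh.symm)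
  have hpend : ∀ e ∈ M ∪ N, ∃ u x, e = s(u, x) ∧ G.Adj v u ∧ G.Adj u x ∧ x ≠ v ∧
      ((u ≠ u₁ ∧ x = φ u) ∨ (u = u₁ ∧ x = w₁) ∨ (u = u₀ ∧ x = w₀)) := by
    intro e he
    simp only [hMdef, N, Finset.mem_union, Finset.mem_image, Finset.mem_insert,
      Finset.mem_singleton] at he
    obtain ⟨u, hu, rfl⟩ | rfl | rfl := he
    · exact ⟨u, _, rfl, hφ.adj_root u hu, hφ.adj u hu, hφ.ne u hu,
        Or.inl ⟨Finset.ne_of_mem_erase hu, rfl⟩⟩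
    · exact ⟨_, _, rfl, hu₁, hw₁, hwv₁, by simp⟩
    · exact ⟨_, _, rfl, hu₀, hw₀, hwv₀, by simp⟩
  have hMN : (M ∪ N).card = 6 := by
    rw [Finset.card_union_of_disjoint, hMcard, Finset.card_pair]
    · intro hh
      exact hne.symm (eq_of_mem_pendants htf hff hu₁ hu₀ hw₁ hw₀ hwv₁ (w := u₁) (by simp)
        (hh ▸ by simp))
    · rw [Finset.disjoint_left]
      intro e heM heN
      rw [hMdef, Finset.mem_image] at heM
      obtain ⟨u, hu, rfl⟩ := heM
      simp only [N, Finset.mem_insert, Finset.mem_singleton] at heN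
      rcases heN with heN | heN
      · exact Finset.ne_of_mem_erase hu (eq_of_mem_pendants htf hff (w := u)
          (hφ.adj_root u hu) hu₁ (hφ.adj u hu) hw₁ (hφ.ne u hu) (by simp) (heN ▸ by simp))
      · obtain rfl := eq_of_mem_pendants htf hff (w := u)
          (hφ.adj_root u hu) hu₀ (hφ.adj u hu) hw₀ (hφ.ne u hu) (by simp) (heN ▸ by simp)
        exact hw₀φ (Sym2.congr_right.1 heN).symm
  have near : ∀ y, G.Adj v y → Slack G (precolor M N) (edgeDist G v) v y := by
    intro y hy
    refine ⟨∅, by simp, by simp, ?_⟩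
    have h1 := card_nearKeys_precolor_add_card_le (G := G) (u := v) (v := y)
      (subset_refl (M ∪ N)) (fun e he => by
        obtain ⟨u, x, rfl, h1, h2, h3, -⟩ := hpend e he
        exact mem_nearEdges_of_pendant hy h1 h2 h3)
    rw [hMN] at h1
    have h2 := card_nearDarts_le hdeg hy
    have h4 := card_nearEdges_le_card_nearDarts (G := G) v y
    rw [Finset.card_empty]
    omega
  have huniq : ∀ w, w ≠ u₀ → ∀ y y', G.Adj w y → G.Adj w y' → precolor M N s(w, y) ≠ none →
      precolor M N s(w, y') ≠ none → y = y' := by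
    intro w hw y y' _ _ hy hy'
    simp only [ne_eq, precolor_eq_none, not_not] at hy hy'
    obtain ⟨u, x, e, h1, h2, h3, h4⟩ := hpend _ hy
    obtain ⟨u', x', e', h1', h2', h3', h4'⟩ := hpend _ hy'
    obtain rfl := eq_of_mem_pendants htf hff (w := w) h1 h1' h2 h2' h3 (e ▸ by simp)
      (e' ▸ by simp)
    rw [Sym2.eq_iff] at e e'
    have := h2.ne
    grind
  have hu₀y : ∀ y, precolor M N s(u₀, y) ≠ none → y = φ u₀ ∨ y = w₀ := by
    intro y hy
    simp only [ne_eq, precolor_eq_none, not_not] at hy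
    obtain ⟨u, x, e, h1, h2, h3, h4⟩ := hpend _ hy
    rw [Sym2.eq_iff] at e
    rcases e with ⟨rfl, rfl⟩ | ⟨rfl, rfl⟩
    · tauto
    · exact absurd hu₀ (htf _ _ _ h1 h2)
  have far : ∀ x y, G.Adj x y → x ≠ v → y ≠ v → G.dist v x ≤ G.dist v y →
      Slack G (precolor M N) (edgeDist G v) x y := by
    intro x y hxy hxv hyv hle
    obtain ⟨w, hxw, hw⟩ := exists_adj_dist_lt hG hxv
    by_cases hwu : w = u₀
    · subst hwu
      have hyw : y ≠ w := by rintro rfl; omega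
      have hd : G.dist v w = 1 := SimpleGraph.dist_eq_one_iff_adj.2 hu₀
      obtain ⟨u, huw, hvu, huy⟩ := hsat.exists_adj hreg htf hff hu₀ hxw.symm hxv hxy hyw
      let F := (G.neighborFinset w).filter fun t => precolor M N s(w, t) = none
      have hF : 3 ≤ F.card := by
        have h1 := Finset.card_filter_add_card_filter_not (s := G.neighborFinset w)
          (fun t => precolor M N s(w, t) = none)
        have h2 : ((G.neighborFinset w).filter fun t => ¬ precolor M N s(w, t) = none) ⊆
            {φ w, w₀} := by
          intro t ht
          simpa using hu₀y t (Finset.mem_filter.1 ht).2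
        have h3 := (Finset.card_le_card h2).trans Finset.card_le_two
        rw [G.card_neighborFinset_eq_degree, hreg] at h1
        change 3 ≤ (Finset.filter _ _).card
        omega
      refine ⟨insert s(u, v) (F.image fun t => s(w, t)), ?_, ?_, ?_⟩
      · rw [Finset.insert_subset_iff]
        refine ⟨mem_nearEdges_of_right huy.symm ?_ hvu.symm, ?_⟩
        · rintro rfl
          exact htf _ _ _ hu₀ hxw.symm hvu
        · intro e he
          simp only [F, Finset.mem_image, Finset.mem_filter, mem_neighborFinset] at he
          obtain ⟨t, ⟨ht, -⟩, rfl⟩ := he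
          exact mem_nearEdges_of_left hxw hyw.symm ht
      · intro e he
        simp only [F, Finset.mem_insert, Finset.mem_image, Finset.mem_filter,
          mem_neighborFinset] at he
        rcases he with rfl | ⟨t, ⟨ht, ht'⟩, rfl⟩
        · refine ⟨precolor_eq_none.2 fun hh => ?_, ?_⟩
          · obtain ⟨a, b, e, h1, h2, h3, -⟩ := hpend _ hh
            rw [Sym2.eq_iff] at e
            rcases e with ⟨rfl, rfl⟩ | ⟨rfl, rfl⟩
            · exact h3 rfl
            · exact h1.ne rfl
          · simp only [edgeDist_mk, SimpleGraph.dist_self]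
            omega
        · refine ⟨ht', ?_⟩
          simp only [edgeDist_mk]
          omega
      · rw [Finset.card_insert_of_notMem, Finset.card_image_of_injective]
        · have h2 := card_nearDarts_le hdeg hxy
          have h4 := card_nearEdges_le_card_nearDarts (G := G) x y
          have h5 := card_nearKeys_le_card_nearEdges (G := G) (precolor M N) x y
          omega
        · exact fun t t' h => Sym2.congr_right.1 h
        · intro hh
          rw [Finset.mem_image] at hh
          obtain ⟨t, -, ht⟩ := hh
          rw [Sym2.eq_iff] at ht
          rcases ht with ⟨rfl, -⟩ | ⟨rfl, -⟩
          · exact huw rfl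
          · exact hu₀.ne rfl
    · refine slack_of_later_vertex hdeg hxy hxw (by rintro rfl; omega) (fun t _ => ?_)
        (huniq w hwu)
      simp only [edgeDist_mk]
      omega
  refine exists_coloring_of_slack (properPrecoloring_precolor hM hN) (edgeDist G v)
    fun x y hxy _ => ?_
  by_cases hx : x = v
  · subst hx
    exact near y hxy
  by_cases hy : y = v
  · subst hy
    exact slack_comm (near x hxy.symm)
  rcases le_total (G.dist v x) (G.dist v y) with hle | hle
  · exact far x y hxy hx hy hle
  · exact slack_comm (far y x hxy.symm hy hx hle)

theorem exists_coloring_of_fourCycleFree (hG : G.Connected) (hreg : ∀ x, G.degree x = 5)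
    (htf : TriangleFree G) (hff : FourCycleFree G) :
    ∃ c : G.edgeSet → Fin 37, IsStrongEdgeColoring G c := by
  obtain ⟨v⟩ := hG.nonempty
  by_cases hsat : Saturated G v
  · exact exists_coloring_of_saturated hG hreg htf hff hsat
  · unfold Saturated at hsat
    push Not at hsat
    obtain ⟨u, u', w, hu, hu', hne, hw, hwv, hs⟩ := hsat
    exact exists_coloring_of_unsaturated hG hreg htf hff hu hu' hne hw hwv hs

end Star

theorem exists_coloring_of_connected {V : Type*} [Fintype V] {G : SimpleGraph V}
    [DecidableRel G.Adj] (hG : G.Connected) (hdeg : ∀ x, G.degree x ≤ 5) :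
    ∃ c : G.edgeSet → Fin 37, IsStrongEdgeColoring G c := by
  classical
  by_cases hreg : ∀ x, G.degree x = 5
  · by_cases htf : TriangleFree G
    · by_cases hff : FourCycleFree G
      · exact exists_coloring_of_fourCycleFree hG hreg htf hff
      · unfold FourCycleFree at hff
        push Not at hff
        obtain ⟨a, b, c, d, h⟩ := hff
        exact h.exists_coloring hG hreg htf
    · unfold TriangleFree at htf
      push Not at htf
      obtain ⟨a, b, c, hab, hbc, hac⟩ := htf
      exact exists_coloring_of_triangle hG hdeg hab hac hbc
  · push Not at hreg
    obtain ⟨a, ha⟩ := hreg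
    exact exists_coloring_of_degree_le_four hG hdeg (a := a) (by have := hdeg a; omega)

/-- Colorings of the connected components can be put together. -/
lemma exists_coloring_of_components {V : Type*} {G : SimpleGraph V} {k : ℕ}
    (h : ∀ C : G.ConnectedComponent,
      ∃ c : C.toSimpleGraph.edgeSet → Fin k, IsStrongEdgeColoring C.toSimpleGraph c) :
    ∃ c : G.edgeSet → Fin k, IsStrongEdgeColoring G c := by
  choose c hc using h
  have lift : ∀ e : G.edgeSet, ∃ C : G.ConnectedComponent, ∃ f : C.toSimpleGraph.edgeSet,
      (f : Sym2 C).map Subtype.val = e := by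
    rintro ⟨e, he⟩
    induction e with
    | _ x y =>
      have hy : y ∈ (G.connectedComponentMk x).supp :=
        SimpleGraph.ConnectedComponent.sound (SimpleGraph.Adj.reachable he).symm
      exact ⟨G.connectedComponentMk x, ⟨s(⟨x, rfl⟩, ⟨y, hy⟩), he⟩, rfl⟩
  choose C f hf using lift
  refine ⟨fun e => c (C e) (f e), fun e e' hne hnear heq => ?_⟩
  have hmem : ∀ e : G.edgeSet, ∀ x ∈ (e : Sym2 V), ∃ hx : x ∈ (C e).supp,
      (⟨x, hx⟩ : C e) ∈ (f e : Sym2 (C e)) := by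
    intro e x hx
    rw [← hf e, Sym2.mem_map] at hx
    obtain ⟨z, hz, rfl⟩ := hx
    exact ⟨z.2, hz⟩
  have hC : C e = C e' := by
    rcases hnear with ⟨x, hx, hx'⟩ | ⟨x, y, hx, hy, hxy⟩
    · exact (hmem e x hx).1.symm.trans (hmem e' x hx').1
    · exact (hmem e x hx).1.symm.trans
        ((SimpleGraph.ConnectedComponent.sound hxy.reachable).trans (hmem e' y hy).1)
  have transport : ∀ D D' : G.ConnectedComponent, D = D' → ∀ g' : D'.toSimpleGraph.edgeSet,
      ∃ g : D.toSimpleGraph.edgeSet,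
        (g : Sym2 D).map Subtype.val = (g' : Sym2 D').map Subtype.val ∧ c D g = c D' g' := by
    rintro D _ rfl g'
    exact ⟨g', rfl, rfl⟩
  obtain ⟨g, hg, hgc⟩ := transport _ _ hC (f e')
  rw [hf e'] at hg
  refine hc (C e) (f e) g ?_ ?_ (heq.trans hgc.symm)
  · rintro rfl
    exact hne (Subtype.ext ((hf e).symm.trans hg))
  · have hg_mem : ∀ y ∈ (e' : Sym2 V), ∃ z ∈ (g : Sym2 (C e)), (z : V) = y := by
      intro y hy
      rwa [← hg, Sym2.mem_map] at hy
    rcases hnear with ⟨x, hx, hx'⟩ | ⟨x, y, hx, hy, hxy⟩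
    · obtain ⟨hxC, hxe⟩ := hmem e x hx
      obtain ⟨z, hz, rfl⟩ := hg_mem x hx'
      exact Or.inl ⟨z, hxe, hz⟩
    · obtain ⟨hxC, hxe⟩ := hmem e x hx
      obtain ⟨z, hz, rfl⟩ := hg_mem y hy
      exact Or.inr ⟨⟨x, hxC⟩, z, hxe, hz, hxy⟩

end StrongEdgeColoring

/-- If `G` is a finite simple graph with maximum degree 5, then `G` has a strong
edge-coloring that uses at most 37 colors. -/
theorem strong_edge_coloring_of_maxDegree_five {V : Type*} [Fintype V]
    (G : SimpleGraph V) [DecidableRel G.Adj]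
    (hΔ : G.maxDegree = 5) :
    ∃ c : G.edgeSet → Fin 37, IsStrongEdgeColoring G c := by
  classical
  refine StrongEdgeColoring.exists_coloring_of_components fun C => ?_
  refine StrongEdgeColoring.exists_coloring_of_connected C.connected_toSimpleGraph fun x => ?_
  refine le_trans ?_ (hΔ ▸ G.degree_le_maxDegree x.1)
  refine Finset.card_le_card_of_injOn Subtype.val (fun y hy => ?_) Subtype.val_injective.injOn
  have hxy : C.toSimpleGraph.Adj x y := by simpa using hy
  have hxy' : G.Adj x.1 y.1 := hxy
  simpa using hxy'
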